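/- arXiv:1410.3244 — 5 statements merged into one kernel-verified Lean document; each statement's English description precedes it below -/
import Mathlib

section
/- Let n₁ = V₁ ⊕ ℝ^{t+u} be a pseudo H-type Lie algebra of signature (t,u) with structure map J¹, let n₂ = V₂ ⊕ ℝ^{r+s} be a pseudo H-type Lie algebra of signature (r,s) with structure map J², where t+u = r+s ≥ 1, and let f : n₁ → n₂ be a Lie algebra isomorphism mapping ℝ^{t+u} onto ℝ^{r+s}. Let C : ℝ^{t+u} → ℝ^{r+s} be the restriction of f to the centers and let A : V₁ → V₂ be the composition of the restriction of f to V₁ with the projection of n₂ onto V₂ along ℝ^{r+s}. Then for every Z ∈ ℝ^{r+s} and all v, w ∈ V₁ one has ⟨J²_Z(A w), A v⟩_{V₂} = ⟨J¹_{C^τ(Z)} w, v⟩_{V₁}; equivalently A^τ ∘ J²_Z ∘ A = J¹_{C^τ(Z)}. -/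
/-- The standard scalar product of signature `(r,s)` on `ℝ^(r+s)`:
`⟨Z,W⟩_{r,s} = ∑_{i<r} Z i * W i - ∑_{r ≤ i < r+s} Z i * W i`. -/
def sform (r s : ℕ) (Z W : Fin (r + s) → ℝ) : ℝ :=
  ∑ i : Fin (r + s), (if (i : ℕ) < r then (1 : ℝ) else -1) * Z i * W i

/-- `(V, B, J)` is an admissible module of the Clifford algebra `Cl_{r,s}`:
`V` is a nonzero finite-dimensional real vector space, `B` a nondegenerate
symmetric bilinear form on `V`, and `J : ℝ^{r+s} → End V` linear with
`J_Z ∘ J_Z = -⟨Z,Z⟩_{r,s} • id` and each `J_Z` skew-adjoint w.r.t. `B`. -/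
def IsAdmissible (r s : ℕ) (V : Type) [AddCommGroup V] [Module ℝ V]
    (B : V →ₗ[ℝ] V →ₗ[ℝ] ℝ)
    (J : (Fin (r + s) → ℝ) →ₗ[ℝ] V →ₗ[ℝ] V) : Prop :=
  FiniteDimensional ℝ V ∧ Nontrivial V ∧
  (∀ v w : V, B v w = B w v) ∧
  (∀ v : V, (∀ w : V, B v w = 0) → v = 0) ∧
  (∀ (Z : Fin (r + s) → ℝ) (v : V), J Z (J Z v) = (-(sform r s Z Z)) • v) ∧
  (∀ (Z : Fin (r + s) → ℝ) (v w : V), B (J Z v) w = -(B v (J Z w)))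

/-- A minimal admissible `Cl_{r,s}`-module: one of least possible dimension. -/
def IsMinimalAdmissible (r s : ℕ) (V : Type) [AddCommGroup V] [Module ℝ V]
    (B : V →ₗ[ℝ] V →ₗ[ℝ] ℝ)
    (J : (Fin (r + s) → ℝ) →ₗ[ℝ] V →ₗ[ℝ] V) : Prop :=
  IsAdmissible r s V B J ∧
  ∀ (V' : Type) [AddCommGroup V'] [Module ℝ V']
    (B' : V' →ₗ[ℝ] V' →ₗ[ℝ] ℝ)
    (J' : (Fin (r + s) → ℝ) →ₗ[ℝ] V' →ₗ[ℝ] V'),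
    IsAdmissible r s V' B' J' → Module.finrank ℝ V ≤ Module.finrank ℝ V'

/-- `br` is the Lie bracket of the pseudo `H`-type Lie algebra `V ⊕ ℝ^{r+s}`
determined by the admissible module `(V,B,J)`, i.e.
`⟨Z, [v,w]⟩_{r,s} = ⟨J_Z v, w⟩_V` for all `Z, v, w`. -/
def IsHBracket (r s : ℕ) (V : Type) [AddCommGroup V] [Module ℝ V]
    (B : V →ₗ[ℝ] V →ₗ[ℝ] ℝ)
    (J : (Fin (r + s) → ℝ) →ₗ[ℝ] V →ₗ[ℝ] V)
    (br : V →ₗ[ℝ] V →ₗ[ℝ] (Fin (r + s) → ℝ)) : Prop :=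
  ∀ (Z : Fin (r + s) → ℝ) (v w : V), sform r s Z (br v w) = B (J Z v) w

/-- A linear equivalence `f` between the pseudo `H`-type Lie algebras
`V₁ ⊕ ℝ^{n₁}` and `V₂ ⊕ ℝ^{n₂}` (with 2-step brackets `br₁`, `br₂`, the
`ℝ^{nᵢ}` factors being central) is a Lie algebra isomorphism. -/
def IsLieIso {V₁ : Type} [AddCommGroup V₁] [Module ℝ V₁]
    {V₂ : Type} [AddCommGroup V₂] [Module ℝ V₂] {n₁ n₂ : ℕ}
    (br₁ : V₁ →ₗ[ℝ] V₁ →ₗ[ℝ] (Fin n₁ → ℝ))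
    (br₂ : V₂ →ₗ[ℝ] V₂ →ₗ[ℝ] (Fin n₂ → ℝ))
    (f : (V₁ × (Fin n₁ → ℝ)) ≃ₗ[ℝ] (V₂ × (Fin n₂ → ℝ))) : Prop :=
  ∀ x y : V₁ × (Fin n₁ → ℝ),
    f (0, br₁ x.1 y.1) = (0, br₂ (f x).1 (f y).1)

theorem sform_comm (r s : ℕ) (Z W : Fin (r + s) → ℝ) : sform r s Z W = sform r s W Z :=
  Finset.sum_congr rfl fun _ _ => mul_right_comm _ _ _

theorem stmt0 (t u r s : ℕ) (htu : t + u = r + s) (hpos : 1 ≤ r + s)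
    (V1 : Type) [AddCommGroup V1] [Module ℝ V1]
    (B1 : V1 →ₗ[ℝ] V1 →ₗ[ℝ] ℝ)
    (J1 : (Fin (t + u) → ℝ) →ₗ[ℝ] V1 →ₗ[ℝ] V1)
    (br1 : V1 →ₗ[ℝ] V1 →ₗ[ℝ] (Fin (t + u) → ℝ))
    (hadm1 : IsAdmissible t u V1 B1 J1)
    (hbr1 : IsHBracket t u V1 B1 J1 br1)
    (V2 : Type) [AddCommGroup V2] [Module ℝ V2]
    (B2 : V2 →ₗ[ℝ] V2 →ₗ[ℝ] ℝ)
    (J2 : (Fin (r + s) → ℝ) →ₗ[ℝ] V2 →ₗ[ℝ] V2)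
    (br2 : V2 →ₗ[ℝ] V2 →ₗ[ℝ] (Fin (r + s) → ℝ))
    (hadm2 : IsAdmissible r s V2 B2 J2)
    (hbr2 : IsHBracket r s V2 B2 J2 br2)
    (f : (V1 × (Fin (t + u) → ℝ)) ≃ₗ[ℝ] (V2 × (Fin (r + s) → ℝ)))
    (hf : IsLieIso br1 br2 f)
    (C : (Fin (t + u) → ℝ) →ₗ[ℝ] (Fin (r + s) → ℝ))
    (hC : ∀ Z : Fin (t + u) → ℝ, f (0, Z) = (0, C Z))
    (hConto : Function.Surjective ⇑C)
    (A : V1 →ₗ[ℝ] V2)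
    (hA : ∀ v : V1, A v = (f (v, 0)).1)
    (Cτ : (Fin (r + s) → ℝ) →ₗ[ℝ] (Fin (t + u) → ℝ))
    (hCτ : ∀ (Z : Fin (t + u) → ℝ) (ζ : Fin (r + s) → ℝ),
      sform r s (C Z) ζ = sform t u Z (Cτ ζ)) :
    ∀ (Z : Fin (r + s) → ℝ) (v w : V1),
      B2 (J2 Z (A w)) (A v) = B1 (J1 (Cτ Z) w) v := by
  intro Z v w
  have h : C (br1 w v) = br2 (A w) (A v) := by
    have h := hf (w, 0) (v, 0)
    rw [hC, ← hA, ← hA] at h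
    exact congrArg Prod.snd h
  rw [← hbr2, ← hbr1, ← h, sform_comm, hCτ, sform_comm]
end

section
/- Let r ≥ 1 and let n₁ = V₁ ⊕ ℝ^r be a pseudo H-type Lie algebra of signature (r,0). If n₁ is isomorphic as a Lie algebra to a pseudo H-type Lie algebra n₂ = V₂ ⊕ ℝ^{t+u} of signature (t,u) with t + u = r, then (t,u) = (r,0) or (t,u) = (0,r). -/
/-- The linear functional `sform r s Z`. -/
def sformLinear (r s : ℕ) (Z : Fin (r + s) → ℝ) : (Fin (r + s) → ℝ) →ₗ[ℝ] ℝ :=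
  ∑ i : Fin (r + s), ((if (i : ℕ) < r then (1 : ℝ) else -1) * Z i) • LinearMap.proj i

theorem sformLinear_apply (r s : ℕ) (Z W : Fin (r + s) → ℝ) :
    sformLinear r s Z W = sform r s Z W := by
  simp only [sformLinear, sform, LinearMap.sum_apply, LinearMap.smul_apply, LinearMap.proj_apply,
    smul_eq_mul]

theorem sform_single (r s : ℕ) (Z : Fin (r + s) → ℝ) (i : Fin (r + s)) (c : ℝ) :
    sform r s Z (Pi.single i c) = (if (i : ℕ) < r then (1 : ℝ) else -1) * Z i * c := by
  unfold sform
  rw [Finset.sum_eq_single i]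
  · simp
  · intro j _ hj
    simp [hj]
  · simp

/-- A definite form of signature `(r,0)` is anisotropic. -/
theorem eq_zero_of_sform_self_eq_zero {r : ℕ} {Z : Fin (r + 0) → ℝ}
    (h : sform r 0 Z Z = 0) : Z = 0 := by
  have hs : sform r 0 Z Z = ∑ i, Z i * Z i :=
    Finset.sum_congr rfl fun i _ => by rw [if_pos (show (i : ℕ) < r from i.2), one_mul]
  rw [hs, Finset.sum_eq_zero_iff_of_nonneg fun i _ => mul_self_nonneg _] at h
  funext i
  exact mul_self_eq_zero.mp (h i (Finset.mem_univ i))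

/-- Every linear functional is represented by the definite form of signature `(r,0)`. -/
theorem exists_sform_eq {r : ℕ} (μ : (Fin (r + 0) → ℝ) →ₗ[ℝ] ℝ) :
    ∃ Z, ∀ W, sform r 0 Z W = μ W := by
  refine ⟨fun i => μ (Pi.single i 1), fun W => ?_⟩
  have h : sformLinear r 0 (fun i => μ (Pi.single i 1)) = μ := by
    refine LinearMap.pi_ext fun i c => ?_
    rw [sformLinear_apply, sform_single, if_pos (show (i : ℕ) < r from i.2), one_mul, mul_comm,
      ← smul_eq_mul, ← map_smul, ← Pi.single_smul, smul_eq_mul, mul_one]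
  rw [← sformLinear_apply, h]

/-- An indefinite signature has a nonzero null vector. -/
theorem exists_ne_zero_sform_self_eq_zero {t u : ℕ} (ht : 0 < t) (hu : 0 < u) :
    ∃ Z : Fin (t + u) → ℝ, Z ≠ 0 ∧ sform t u Z Z = 0 := by
  let i : Fin (t + u) := ⟨0, by omega⟩
  let j : Fin (t + u) := ⟨t, by omega⟩
  have hij : i ≠ j := fun h => ht.ne (congrArg Fin.val h)
  refine ⟨Pi.single i 1 + Pi.single j 1, fun h => ?_, ?_⟩
  · have := congrFun h i
    simp [hij] at this
  · rw [← sformLinear_apply, map_add, sformLinear_apply, sformLinear_apply, sform_single,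
      sform_single, if_pos (show (i : ℕ) < t from ht),
      if_neg (show ¬ (j : ℕ) < t from lt_irrefl t)]
    simp [hij, hij.symm]

section

variable {r s : ℕ} {V : Type} [AddCommGroup V] [Module ℝ V] {B : V →ₗ[ℝ] V →ₗ[ℝ] ℝ}
  {J : (Fin (r + s) → ℝ) →ₗ[ℝ] V →ₗ[ℝ] V} {br : V →ₗ[ℝ] V →ₗ[ℝ] (Fin (r + s) → ℝ)}

theorem IsAdmissible.apply_eq_zero (hadm : IsAdmissible r s V B J) (hbr : IsHBracket r s V B J br)
    {Z : Fin (r + s) → ℝ} {v : V} (h : ∀ w, sform r s Z (br v w) = 0) : J Z v = 0 :=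
  hadm.2.2.2.1 _ fun w => by rw [← hbr, h]

/-- If `J_Z v = 0` with `v ≠ 0`, then `Z` is a null vector. -/
theorem IsAdmissible.sform_self_eq_zero (hadm : IsAdmissible r s V B J)
    {Z : Fin (r + s) → ℝ} {v : V} (hv : v ≠ 0) (h : J Z v = 0) : sform r s Z Z = 0 := by
  have h2 := hadm.2.2.2.2.1 Z v
  rw [h, map_zero, eq_comm, smul_eq_zero, neg_eq_zero] at h2
  exact h2.resolve_right hv

/-- An element of `V` which is central in the pseudo `H`-type algebra vanishes. -/
theorem IsAdmissible.eq_zero_of_bracket_eq_zero (hadm : IsAdmissible r s V B J)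
    (hbr : IsHBracket r s V B J br) (hrs : 0 < r + s) {v : V} (h : ∀ w, br v w = 0) : v = 0 := by
  by_contra hv
  have hJ : J (Pi.single ⟨0, hrs⟩ 1) v = 0 := hadm.apply_eq_zero hbr fun w => by
    rw [h, ← sformLinear_apply, map_zero]
  have h0 := hadm.sform_self_eq_zero hv hJ
  rw [sform_single] at h0
  split_ifs at h0 <;> simp at h0

/-- If `Z` is null, then `J_Z` has a nontrivial kernel. -/
theorem IsAdmissible.exists_ne_zero_apply_eq_zero (hadm : IsAdmissible r s V B J)
    {Z : Fin (r + s) → ℝ} (hZ : sform r s Z Z = 0) : ∃ v, v ≠ 0 ∧ J Z v = 0 := by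
  have := hadm.2.1
  obtain ⟨v, hv⟩ := exists_ne (0 : V)
  by_cases h : J Z v = 0
  · exact ⟨v, hv, h⟩
  · exact ⟨J Z v, h, by rw [hadm.2.2.2.2.1, hZ, neg_zero, zero_smul]⟩

end

theorem stmt1 (r : ℕ) (hr : 1 ≤ r)
    (V1 : Type) [AddCommGroup V1] [Module ℝ V1]
    (B1 : V1 →ₗ[ℝ] V1 →ₗ[ℝ] ℝ)
    (J1 : (Fin (r + 0) → ℝ) →ₗ[ℝ] V1 →ₗ[ℝ] V1)
    (br1 : V1 →ₗ[ℝ] V1 →ₗ[ℝ] (Fin (r + 0) → ℝ))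
    (hadm1 : IsAdmissible r 0 V1 B1 J1)
    (hbr1 : IsHBracket r 0 V1 B1 J1 br1)
    (t u : ℕ) (htu : t + u = r)
    (V2 : Type) [AddCommGroup V2] [Module ℝ V2]
    (B2 : V2 →ₗ[ℝ] V2 →ₗ[ℝ] ℝ)
    (J2 : (Fin (t + u) → ℝ) →ₗ[ℝ] V2 →ₗ[ℝ] V2)
    (br2 : V2 →ₗ[ℝ] V2 →ₗ[ℝ] (Fin (t + u) → ℝ))
    (hadm2 : IsAdmissible t u V2 B2 J2)
    (hbr2 : IsHBracket t u V2 B2 J2 br2)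
    (hiso : ∃ f : (V1 × (Fin (r + 0) → ℝ)) ≃ₗ[ℝ] (V2 × (Fin (t + u) → ℝ)),
      IsLieIso br1 br2 f) :
    (t = r ∧ u = 0) ∨ (t = 0 ∧ u = r) := by
  by_contra hcon
  have ht : 0 < t := by omega
  have hu : 0 < u := by omega
  obtain ⟨f, hf⟩ := hiso
  obtain ⟨Z, hZ, hZnull⟩ := exists_ne_zero_sform_self_eq_zero ht hu
  obtain ⟨v, hv, hJv⟩ := hadm2.exists_ne_zero_apply_eq_zero hZnull
  obtain ⟨Z₁, hZ₁⟩ := exists_sform_eq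
    (sformLinear t u Z ∘ₗ LinearMap.snd ℝ V2 _ ∘ₗ f.toLinearMap ∘ₗ LinearMap.inr ℝ V1 _)
  replace hZ₁ : ∀ W, sform r 0 Z₁ W = sform t u Z (f (0, W)).2 := fun W => by
    rw [hZ₁, ← sformLinear_apply]
    rfl
  have hx : (f.symm (v, 0)).1 ≠ 0 := by
    refine fun h0 => hv (hadm2.eq_zero_of_bracket_eq_zero hbr2 (by omega) fun w => ?_)
    have h := hf (f.symm (v, 0)) (f.symm (w, 0))
    rw [h0, map_zero, LinearMap.zero_apply, f.apply_symm_apply, f.apply_symm_apply,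
      ← Prod.zero_eq_mk, map_zero] at h
    exact (congrArg Prod.snd h).symm
  have hJ₁ : J1 Z₁ (f.symm (v, 0)).1 = 0 := hadm1.apply_eq_zero hbr1 fun w => by
    have h := hf (f.symm (v, 0)) (w, 0)
    rw [f.apply_symm_apply] at h
    rw [hZ₁, h, hbr2, hJv, map_zero, LinearMap.zero_apply]
  have hZ₁0 : Z₁ = 0 :=
    eq_zero_of_sform_self_eq_zero (hadm1.sform_self_eq_zero hx hJ₁)
  refine hZ (funext fun i => ?_)
  have hy : (f.symm (0, Pi.single i 1)).1 = 0 := by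
    refine hadm1.eq_zero_of_bracket_eq_zero hbr1 (by omega) fun w => ?_
    have h := hf (f.symm (0, Pi.single i 1)) (w, 0)
    rw [f.apply_symm_apply, map_zero, LinearMap.zero_apply, ← Prod.zero_eq_mk,
      f.map_eq_zero_iff] at h
    exact congrArg Prod.snd h
  have h := hZ₁ (f.symm (0, Pi.single i 1)).2
  rw [← hy, Prod.mk.eta, f.apply_symm_apply, sform_single, hZ₁0, ← sformLinear_apply] at h
  split_ifs at h <;> simpa [sformLinear] using h.symm
end

section
/- Let r,s ≥ 1 and let n₁ = V₁ ⊕ ℝ^{r+s} be a pseudo H-type Lie algebra of signature (r,s). If n₁ is isomorphic as a Lie algebra to a pseudo H-type Lie algebra n₂ = V₂ ⊕ ℝ^{t+u} of signature (t,u) with t + u = r + s, then either (t,u) = (r,s) or (t,u) = (s,r). -/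
/-- The form `sform r s` as a bilinear map. -/
def sformBilin (r s : ℕ) :
    (Fin (r + s) → ℝ) →ₗ[ℝ] (Fin (r + s) → ℝ) →ₗ[ℝ] ℝ :=
  LinearMap.mk₂ ℝ (sform r s)
    (fun x y z => by
      simp only [sform, Pi.add_apply, mul_add, add_mul, Finset.sum_add_distrib])
    (fun c x y => by
      simp only [sform, Pi.smul_apply, smul_eq_mul, Finset.mul_sum]
      exact Finset.sum_congr rfl fun i _ => by ring)
    (fun x y z => by
      simp only [sform, Pi.add_apply, mul_add, Finset.sum_add_distrib])
    (fun c x y => by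
      simp only [sform, Pi.smul_apply, smul_eq_mul, Finset.mul_sum]
      exact Finset.sum_congr rfl fun i _ => by ring)

@[simp]
theorem sformBilin_apply (r s : ℕ) (x y : Fin (r + s) → ℝ) :
    sformBilin r s x y = sform r s x y := rfl

theorem sform_single_left (r s : ℕ) (i : Fin (r + s)) (c : ℝ) (x : Fin (r + s) → ℝ) :
    sform r s (Pi.single i c) x = (if (i : ℕ) < r then (1 : ℝ) else -1) * c * x i := by
  rw [sform, Finset.sum_eq_single i]
  · simp
  · intro j _ hj
    simp [Pi.single_eq_of_ne hj]
  · simp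

theorem sform_self (r s : ℕ) (x : Fin (r + s) → ℝ) :
    sform r s x x =
      ∑ i, x (Fin.castAdd s i) ^ 2 - ∑ j, x (Fin.natAdd r j) ^ 2 := by
  rw [sform, Fin.sum_univ_add, sub_eq_add_neg, ← Finset.sum_neg_distrib]
  congr 1 <;> refine Finset.sum_congr rfl fun i _ => ?_
  · simp [sq]
  · simp [sq]

/-- Every linear functional is represented by `sform t u`; here for the functionals
`w ↦ ⟨z, D w⟩_{r,s}`, linearly in `z`. -/
theorem exists_sform_adjoint (r s t u : ℕ)
    (D : (Fin (t + u) → ℝ) →ₗ[ℝ] (Fin (r + s) → ℝ)) :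
    ∃ S : (Fin (r + s) → ℝ) →ₗ[ℝ] (Fin (t + u) → ℝ),
      ∀ z w, sform t u (S z) w = sform r s z (D w) := by
  refine ⟨LinearMap.pi fun i => (if (i : ℕ) < t then (1 : ℝ) else -1) •
    (sformBilin r s).flip (D (Pi.single i 1)), fun z w => ?_⟩
  have hw : D w = ∑ i, w i • D (Pi.single i 1) := by
    conv_lhs => rw [pi_eq_sum_univ' w]
    simp [map_sum, Pi.single]
  rw [← sformBilin_apply r s, hw, map_sum, sform]
  refine Finset.sum_congr rfl fun i _ => ?_
  simp only [LinearMap.pi_apply, LinearMap.smul_apply, LinearMap.flip_apply, map_smul,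
    smul_eq_mul]
  split_ifs <;> ring

/-- A subspace on which `sform t u` is positive definite has dimension at most `t`. -/
theorem le_of_sform_pos {k t u : ℕ} (E : (Fin k → ℝ) →ₗ[ℝ] (Fin (t + u) → ℝ))
    (hE : ∀ x, x ≠ 0 → 0 < sform t u (E x) (E x)) : k ≤ t := by
  have hinj : Function.Injective (LinearMap.funLeft ℝ ℝ (Fin.castAdd u) ∘ₗ E) := by
    rw [injective_iff_map_eq_zero]
    intro x hx
    by_contra hne
    have hpos := hE x hne
    have hz : ∀ i, E x (Fin.castAdd u i) = 0 := fun i => congrFun hx i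
    have hn : 0 ≤ ∑ j, E x (Fin.natAdd t j) ^ 2 := Finset.sum_nonneg fun _ _ => sq_nonneg _
    simp only [sform_self, hz] at hpos
    simp at hpos
    linarith
  simpa using LinearMap.finrank_le_finrank_of_injective hinj

/-- A subspace on which `sform t u` is negative definite has dimension at most `u`. -/
theorem le_of_sform_neg {k t u : ℕ} (E : (Fin k → ℝ) →ₗ[ℝ] (Fin (t + u) → ℝ))
    (hE : ∀ x, x ≠ 0 → sform t u (E x) (E x) < 0) : k ≤ u := by
  have hinj : Function.Injective (LinearMap.funLeft ℝ ℝ (Fin.natAdd t) ∘ₗ E) := by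
    rw [injective_iff_map_eq_zero]
    intro x hx
    by_contra hne
    have hneg := hE x hne
    have hz : ∀ i, E x (Fin.natAdd t i) = 0 := fun i => congrFun hx i
    have hn : 0 ≤ ∑ j, E x (Fin.castAdd u j) ^ 2 := Finset.sum_nonneg fun _ _ => sq_nonneg _
    simp only [sform_self, hz] at hneg
    simp at hneg
    linarith
  simpa using LinearMap.finrank_le_finrank_of_injective hinj

/-- The inclusion of the positive definite coordinate subspace. -/
def posIncl (r s : ℕ) : (Fin r → ℝ) →ₗ[ℝ] (Fin (r + s) → ℝ) where
  toFun x := Fin.append x 0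
  map_add' x y := by
    ext i
    refine Fin.addCases (fun i => ?_) (fun i => ?_) i <;> simp
  map_smul' c x := by
    ext i
    refine Fin.addCases (fun i => ?_) (fun i => ?_) i <;> simp

/-- The inclusion of the negative definite coordinate subspace. -/
def negIncl (r s : ℕ) : (Fin s → ℝ) →ₗ[ℝ] (Fin (r + s) → ℝ) where
  toFun y := Fin.append 0 y
  map_add' x y := by
    ext i
    refine Fin.addCases (fun i => ?_) (fun i => ?_) i <;> simp
  map_smul' c x := by
    ext i
    refine Fin.addCases (fun i => ?_) (fun i => ?_) i <;> simp

theorem sform_posIncl_add_negIncl (r s : ℕ) (x : Fin r → ℝ) (y : Fin s → ℝ) :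
    sform r s (posIncl r s x + negIncl r s y) (posIncl r s x + negIncl r s y) =
      ∑ i, x i ^ 2 - ∑ j, y j ^ 2 := by
  simp [sform_self, posIncl, negIncl]

theorem sum_sq_pos {k : ℕ} {x : Fin k → ℝ} (hx : x ≠ 0) : 0 < ∑ i, x i ^ 2 := by
  obtain ⟨i, hi⟩ := Function.ne_iff.mp hx
  exact Finset.sum_pos' (fun _ _ => sq_nonneg _) ⟨i, Finset.mem_univ i, sq_pos_of_ne_zero hi⟩

/-- A bilinear form whose null cone is that of the indefinite form `sform r s` is, up to a common
nonzero scalar, the standard form on the positive and on the negative coordinate subspace. -/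
theorem exists_scalar_of_null_iff {r s : ℕ} (hr : 1 ≤ r) (hs : 1 ≤ s)
    (b : (Fin (r + s) → ℝ) →ₗ[ℝ] (Fin (r + s) → ℝ) →ₗ[ℝ] ℝ)
    (hb : ∀ z, b z z = 0 ↔ sform r s z z = 0) :
    ∃ c : ℝ, c ≠ 0 ∧
      (∀ x, b (posIncl r s x) (posIncl r s x) = c * ∑ i, x i ^ 2) ∧
      ∀ y, b (negIncl r s y) (negIncl r s y) = -(c * ∑ j, y j ^ 2) := by
  have key : ∀ x y, ∑ i, x i ^ 2 = ∑ j, y j ^ 2 →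
      b (posIncl r s x) (posIncl r s x) = -b (negIncl r s y) (negIncl r s y) := by
    intro x y h
    have h₁ := (hb (posIncl r s x + negIncl r s y)).2 (by
      rw [sform_posIncl_add_negIncl, h, sub_self])
    have h₂ := (hb (posIncl r s x + negIncl r s (-y))).2 (by
      rw [sform_posIncl_add_negIncl, h]; simp)
    simp only [map_add, map_neg, LinearMap.add_apply, LinearMap.neg_apply] at h₁ h₂
    linarith
  have hsum : ∀ {k : ℕ} (i : Fin k) (a : ℝ), ∑ j, (Pi.single i a : Fin k → ℝ) j ^ 2 = a ^ 2 := by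
    intro k i a
    rw [Finset.sum_eq_single i]
    · simp
    · intro j _ hj
      simp [Pi.single_eq_of_ne hj]
    · simp
  let e : Fin r → ℝ := Pi.single ⟨0, hr⟩ 1
  let d : Fin s → ℝ := Pi.single ⟨0, hs⟩ 1
  have scale : ∀ {k : ℕ} (i : Fin k) (a : ℝ),
      (Pi.single i a : Fin k → ℝ) = a • Pi.single i 1 := by
    intro k i a
    rw [← Pi.single_smul]; simp
  have hed := key e d (by simp only [e, d, hsum])
  have hP : ∀ x, b (posIncl r s x) (posIncl r s x) =
      b (posIncl r s e) (posIncl r s e) * ∑ i, x i ^ 2 := by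
    intro x
    have hx : 0 ≤ ∑ i, x i ^ 2 := Finset.sum_nonneg fun _ _ => sq_nonneg _
    have h := key x (Pi.single ⟨0, hs⟩ √(∑ i, x i ^ 2)) (by rw [hsum, Real.sq_sqrt hx])
    rw [scale] at h
    simp only [map_smul, LinearMap.smul_apply, smul_eq_mul] at h
    rw [h, hed, ← mul_assoc, Real.mul_self_sqrt hx]
    simp only [d]
    ring
  refine ⟨b (posIncl r s e) (posIncl r s e), fun h => ?_, hP, fun y => ?_⟩
  · have h0 := sform_posIncl_add_negIncl r s e 0
    rw [map_zero, add_zero, (hb _).1 h, hsum] at h0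
    simp at h0
  · have hy : 0 ≤ ∑ i, y i ^ 2 := Finset.sum_nonneg fun _ _ => sq_nonneg _
    have h := key (Pi.single ⟨0, hr⟩ √(∑ i, y i ^ 2)) y (by rw [hsum, Real.sq_sqrt hy])
    rw [hP, hsum, Real.sq_sqrt hy] at h
    linarith

section Bracket

variable {r s : ℕ} {V : Type} [AddCommGroup V] [Module ℝ V]
  {B : V →ₗ[ℝ] V →ₗ[ℝ] ℝ}
  {J : (Fin (r + s) → ℝ) →ₗ[ℝ] V →ₗ[ℝ] V}
  {br : V →ₗ[ℝ] V →ₗ[ℝ] (Fin (r + s) → ℝ)}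

/-- The functional `⟨Z, ·⟩` makes the bracket a degenerate form exactly when `Z` is null. -/
theorem IsHBracket.sform_self_eq_zero_iff (hbr : IsHBracket r s V B J br)
    (hadm : IsAdmissible r s V B J) (Z : Fin (r + s) → ℝ) :
    sform r s Z Z = 0 ↔ ∃ v, v ≠ 0 ∧ ∀ w, sform r s Z (br v w) = 0 := by
  obtain ⟨-, hnt, -, hnd, hsq, -⟩ := hadm
  constructor
  · intro hZ
    obtain ⟨v, hv⟩ := exists_ne (0 : V)
    by_cases h : J Z v = 0
    · exact ⟨v, hv, fun w => by rw [hbr, h]; simp⟩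
    · exact ⟨J Z v, h, fun w => by rw [hbr, hsq, hZ]; simp⟩
  · rintro ⟨v, hv, h⟩
    have hJ : J Z v = 0 := hnd _ fun w => by rw [← hbr]; exact h w
    have h2 := hsq Z v
    rw [hJ, map_zero, eq_comm, smul_eq_zero] at h2
    simpa using h2.resolve_right hv

theorem IsHBracket.eq_zero_of_forall (hbr : IsHBracket r s V B J br)
    (hadm : IsAdmissible r s V B J) (hrs : 0 < r + s) {v : V} (hv : ∀ w, br v w = 0) :
    v = 0 := by
  by_contra hne
  have h := (hbr.sform_self_eq_zero_iff hadm (Pi.single ⟨0, hrs⟩ 1)).2 ⟨v, hne, fun w => by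
    rw [hv, ← sformBilin_apply, map_zero]⟩
  rw [sform_single_left] at h
  split_ifs at h <;> simp at h

end Bracket

section LieIso

variable {V₁ : Type} [AddCommGroup V₁] [Module ℝ V₁]
  {V₂ : Type} [AddCommGroup V₂] [Module ℝ V₂] {n₁ n₂ : ℕ}
  {br₁ : V₁ →ₗ[ℝ] V₁ →ₗ[ℝ] (Fin n₁ → ℝ)}
  {br₂ : V₂ →ₗ[ℝ] V₂ →ₗ[ℝ] (Fin n₂ → ℝ)}
  {f : (V₁ × (Fin n₁ → ℝ)) ≃ₗ[ℝ] (V₂ × (Fin n₂ → ℝ))}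

theorem IsLieIso.symm (hf : IsLieIso br₁ br₂ f) : IsLieIso br₂ br₁ f.symm := by
  intro x y
  rw [LinearEquiv.symm_apply_eq, hf]
  simp

/-- An isomorphism maps the centre into the centre. -/
theorem IsLieIso.apply_central_fst (hf : IsLieIso br₁ br₂ f)
    (h₂ : ∀ v, (∀ w, br₂ v w = 0) → v = 0) (z : Fin n₁ → ℝ) : (f (0, z)).1 = 0 := by
  refine h₂ _ fun w => ?_
  have h := hf (0, z) (f.symm (w, 0))
  simp only [map_zero, LinearMap.zero_apply, LinearEquiv.apply_symm_apply] at h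
  rw [← Prod.zero_eq_mk, map_zero] at h
  exact (congrArg Prod.snd h).symm

theorem IsLieIso.apply_fst (hf : IsLieIso br₁ br₂ f)
    (h₂ : ∀ v, (∀ w, br₂ v w = 0) → v = 0) (x : V₁ × (Fin n₁ → ℝ)) :
    (f (x.1, 0)).1 = (f x).1 := by
  have h : x = (x.1, 0) + (0, x.2) := by simp
  conv_rhs => rw [h, map_add, Prod.fst_add, hf.apply_central_fst h₂, add_zero]

/-- An isomorphism induces an isomorphism modulo the centre. -/
theorem IsLieIso.symm_apply_fst (hf : IsLieIso br₁ br₂ f)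
    (h₂ : ∀ v, (∀ w, br₂ v w = 0) → v = 0) (v : V₂) :
    (f ((f.symm (v, 0)).1, 0)).1 = v := by
  rw [hf.apply_fst h₂, LinearEquiv.apply_symm_apply]

end LieIso

theorem stmt2 (r s : ℕ) (hr : 1 ≤ r) (hs : 1 ≤ s)
    (V1 : Type) [AddCommGroup V1] [Module ℝ V1]
    (B1 : V1 →ₗ[ℝ] V1 →ₗ[ℝ] ℝ)
    (J1 : (Fin (r + s) → ℝ) →ₗ[ℝ] V1 →ₗ[ℝ] V1)
    (br1 : V1 →ₗ[ℝ] V1 →ₗ[ℝ] (Fin (r + s) → ℝ))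
    (hadm1 : IsAdmissible r s V1 B1 J1)
    (hbr1 : IsHBracket r s V1 B1 J1 br1)
    (t u : ℕ) (htu : t + u = r + s)
    (V2 : Type) [AddCommGroup V2] [Module ℝ V2]
    (B2 : V2 →ₗ[ℝ] V2 →ₗ[ℝ] ℝ)
    (J2 : (Fin (t + u) → ℝ) →ₗ[ℝ] V2 →ₗ[ℝ] V2)
    (br2 : V2 →ₗ[ℝ] V2 →ₗ[ℝ] (Fin (t + u) → ℝ))
    (hadm2 : IsAdmissible t u V2 B2 J2)
    (hbr2 : IsHBracket t u V2 B2 J2 br2)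
    (hiso : ∃ f : (V1 × (Fin (r + s) → ℝ)) ≃ₗ[ℝ] (V2 × (Fin (t + u) → ℝ)),
      IsLieIso br1 br2 f) :
    (t = r ∧ u = s) ∨ (t = s ∧ u = r) := by
  obtain ⟨f, hf⟩ := hiso
  have hnd1 : ∀ v, (∀ w, br1 v w = 0) → v = 0 := fun v =>
    hbr1.eq_zero_of_forall hadm1 (by omega)
  have hnd2 : ∀ v, (∀ w, br2 v w = 0) → v = 0 := fun v =>
    hbr2.eq_zero_of_forall hadm2 (by omega)
  obtain ⟨S, hS⟩ := exists_sform_adjoint r s t u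
    (LinearMap.snd ℝ V1 _ ∘ₗ f.symm.toLinearMap ∘ₗ LinearMap.inr ℝ V2 _)
  have hbr : ∀ z x y,
      sform t u (S z) (br2 x y) =
        sform r s z (br1 (f.symm (x, 0)).1 (f.symm (y, 0)).1) := by
    intro z x y
    rw [hS]
    simp only [LinearMap.comp_apply, LinearMap.inr_apply, LinearEquiv.coe_coe,
      LinearMap.snd_apply]
    rw [hf.symm (x, 0) (y, 0)]
  have hnull : ∀ z, sform t u (S z) (S z) = 0 ↔ sform r s z z = 0 := by
    intro z
    rw [hbr1.sform_self_eq_zero_iff hadm1, hbr2.sform_self_eq_zero_iff hadm2]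
    constructor
    · rintro ⟨v, hv, h⟩
      refine ⟨(f.symm (v, 0)).1, fun h0 => hv ?_, fun w => ?_⟩
      · rw [← hf.symm_apply_fst hnd2 v, h0, hf.apply_central_fst hnd2]
      · rw [← hf.symm.symm_apply_fst hnd1 w, ← hbr]
        exact h _
    · rintro ⟨v, hv, h⟩
      refine ⟨(f (v, 0)).1, fun h0 => hv ?_, fun w => ?_⟩
      · have h1 := hf.symm.symm_apply_fst hnd1 v
        rw [LinearEquiv.symm_symm, h0, hf.symm.apply_central_fst hnd1] at h1
        exact h1.symm
      · have h1 := hf.symm.symm_apply_fst hnd1 v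
        rw [LinearEquiv.symm_symm] at h1
        rw [hbr, h1]
        exact h _
  obtain ⟨c, hc, hpos, hneg⟩ :=
    exists_scalar_of_null_iff hr hs ((sformBilin t u).compl₁₂ S S) hnull
  simp only [LinearMap.compl₁₂_apply, sformBilin_apply] at hpos hneg
  rcases hc.lt_or_gt with hc | hc
  · have h1 : r ≤ u := le_of_sform_neg (S ∘ₗ posIncl r s) fun x hx => by
      rw [LinearMap.comp_apply, hpos]
      exact mul_neg_of_neg_of_pos hc (sum_sq_pos hx)
    have h2 : s ≤ t := le_of_sform_pos (S ∘ₗ negIncl r s) fun y hy => by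
      rw [LinearMap.comp_apply, hneg]
      exact neg_pos.2 (mul_neg_of_neg_of_pos hc (sum_sq_pos hy))
    omega
  · have h1 : r ≤ t := le_of_sform_pos (S ∘ₗ posIncl r s) fun x hx => by
      rw [LinearMap.comp_apply, hpos]
      exact mul_pos hc (sum_sq_pos hx)
    have h2 : s ≤ u := le_of_sform_neg (S ∘ₗ negIncl r s) fun y hy => by
      rw [LinearMap.comp_apply, hneg]
      exact neg_neg_iff_pos.2 (mul_pos hc (sum_sq_pos hy))
    omega
end

section
/- For each r ∈ {1, 2, 4, 8}, every pseudo H-type Lie algebra n_{r,0} built on a minimal admissible Cl_{r,0}-module is isomorphic as a Lie algebra to every pseudo H-type Lie algebra n_{0,r} built on a minimal admissible Cl_{0,r}-module. -/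
/-- Skew-adjoint endomorphisms `J a`, `a < r`, pairwise anticommuting and with squares `-σ`, where
`σ = ±1`, on a space with a nondegenerate symmetric form `B`. -/
structure SkewClifford {r : ℕ} {V : Type} [AddCommGroup V] [Module ℝ V] (σ : ℝ)
    (B : V →ₗ[ℝ] V →ₗ[ℝ] ℝ) (J : Fin r → V →ₗ[ℝ] V) : Prop where
  sign : σ * σ = 1
  symm : ∀ x y, B x y = B y x
  nondeg : ∀ x, (∀ y, B x y = 0) → x = 0
  sq : ∀ a x, J a (J a x) = -(σ • x)
  anticomm : ∀ a b, a ≠ b → ∀ x, J a (J b x) = -(J b (J a x))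
  skew : ∀ a x y, B (J a x) y = -(B x (J a y))

namespace SkewClifford

variable {r : ℕ} {V : Type} [AddCommGroup V] [Module ℝ V] {σ : ℝ}
  {B : V →ₗ[ℝ] V →ₗ[ℝ] ℝ} {J : Fin r → V →ₗ[ℝ] V}

lemma sort (h : SkewClifford σ B J) (a b : Fin r) (hab : b < a) (x : V) :
    J a (J b x) = -(J b (J a x)) :=
  h.anticomm a b hab.ne' x

lemma smul_smul_self (h : SkewClifford σ B J) (x : V) : σ • σ • x = x := by
  rw [smul_smul, h.sign, one_smul]

lemma apply_self (h : SkewClifford σ B J) (a : Fin r) (x : V) : B (J a x) x = 0 := by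
  have h1 := h.skew a x x
  have h2 := h.symm (J a x) x
  linarith

lemma apply_same (h : SkewClifford σ B J) (a : Fin r) (x y : V) :
    B (J a x) (J a y) = σ * B x y := by
  rw [h.skew, h.sq]
  simp

lemma apply_ne (h : SkewClifford σ B J) {a b : Fin r} (hab : a ≠ b) (x : V) :
    B (J a x) (J b x) = 0 := by
  have h1 := h.skew a x (J b x)
  have h2 := h.skew b x (J a x)
  have h3 := h.symm (J a x) (J b x)
  rw [h.anticomm a b hab, map_neg] at h1
  linarith

lemma apply_apply (h : SkewClifford σ B J) (a b : Fin r) (x : V) :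
    B (J a x) (J b x) = if a = b then σ * B x x else 0 := by
  split_ifs with hab
  · rw [hab, h.apply_same]
  · exact h.apply_ne hab x

lemma exists_apply_self_ne_zero [Nontrivial V] (h : SkewClifford σ B J) : ∃ v, B v v ≠ 0 := by
  by_contra! h0
  obtain ⟨x, hx⟩ := exists_ne (0 : V)
  refine hx (h.nondeg x fun y => ?_)
  have h1 := h0 (x + y)
  simp only [map_add, LinearMap.add_apply, h0, h.symm y x] at h1
  linarith

lemma triples (h : SkewClifford σ B J) (a b c d : Fin r) (hd : a < b ∧ b < c ∧ c < d) {ε : ℝ}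
    {v : V} (hv : J a (J b (J c (J d v))) = ε • v) :
    J a (J b (J c v)) = (σ * ε) • J d v ∧ J a (J b (J d v)) = -((σ * ε) • J c v) ∧
      J a (J c (J d v)) = (σ * ε) • J b v := by
  obtain ⟨hab, hbc, hcd⟩ := hd
  have hb := congrArg (J b) hv
  have hc := congrArg (J c) hv
  have hd := congrArg (J d) hv
  simp only [h.sort b a hab, h.sort c a (hab.trans hbc), h.sort c b hbc, h.sort d c hcd,
    h.sort d b (hbc.trans hcd), h.sort d a (hab.trans (hbc.trans hcd)), h.sq, map_neg, map_smul,
    neg_neg] at hb hc hd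
  refine ⟨?_, ?_, ?_⟩
  · rw [mul_smul, ← hd, h.smul_smul_self]
  · rw [mul_smul, ← hc, smul_neg, h.smul_smul_self, neg_neg]
  · rw [mul_smul, ← hb, h.smul_smul_self]

/-- If `I` is a symmetric involution anticommuting with some `J g`, and both commute with all
operators in `L`, then a non-null vector fixed by `L` can be improved to one fixed by `I` too. -/
lemma exists_fixed_cons (h : SkewClifford σ B J) (I : V →ₗ[ℝ] V) (g : Fin r)
    (L : List (V →ₗ[ℝ] V)) (hI : ∀ x, I (I x) = x) (hs : ∀ x y, B (I x) y = B x (I y))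
    (hg : ∀ x, I (J g x) = -(J g (I x))) (hL : ∀ K ∈ L, ∀ x, K (I x) = I (K x))
    (hLg : ∀ K ∈ L, ∀ x, K (J g x) = J g (K x))
    (hv : ∃ v, B v v ≠ 0 ∧ ∀ K ∈ L, K v = v) :
    ∃ v, B v v ≠ 0 ∧ ∀ K ∈ I :: L, K v = v := by
  obtain ⟨v, hv0, hv⟩ := hv
  by_cases h1 : B (v + I v) (v + I v) = 0
  · refine ⟨J g (v - I v), ?_, ?_⟩
    · rw [h.apply_same]
      refine mul_ne_zero (left_ne_zero_of_mul_eq_one h.sign) fun h2 => hv0 ?_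
      have h3 := hs v (I v)
      rw [hI] at h3
      simp only [map_add, map_sub, LinearMap.add_apply, LinearMap.sub_apply] at h1 h2
      linarith
    · intro K hK
      rcases List.mem_cons.1 hK with rfl | hK
      · rw [hg, map_sub, hI, ← map_neg, neg_sub]
      · rw [hLg K hK, map_sub, hL K hK, hv K hK]
  · refine ⟨v + I v, h1, fun K hK => ?_⟩
    rcases List.mem_cons.1 hK with rfl | hK
    · rw [map_add, hI, add_comm]
    · rw [map_add, hL K hK, hv K hK]

end SkewClifford

/-- The vector `v` is non-null, and `J a (J b (J 0 v)) = ± J (a ^^^ b) v` with signs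
prescribed by `σ` and `t`. -/
def IsCyclicVector {r : ℕ} [NeZero r] {V : Type} [AddCommGroup V] [Module ℝ V] (σ : ℝ)
    (B : V →ₗ[ℝ] V →ₗ[ℝ] ℝ) (J : Fin r → V →ₗ[ℝ] V) (t : Fin r → Fin r → ℝ) (v : V) : Prop :=
  B v v ≠ 0 ∧ ∀ a b, J a (J b (J 0 v)) = (σ * t a b) • J (a ^^^ b) v

/-- Signs of the products of octonion units, up to normalisation. -/
def octonionSign : Fin 8 → Fin 8 → ℝ :=
  !![-1, 1, 1, 1, 1, 1, 1, 1;
     -1, -1, 1, -1, 1, -1, 1, -1;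
     -1, -1, -1, 1, 1, -1, -1, 1;
     -1, 1, -1, -1, -1, -1, 1, 1;
     -1, -1, -1, 1, -1, 1, 1, -1;
     -1, 1, 1, 1, -1, -1, -1, -1;
     -1, -1, 1, -1, -1, 1, -1, 1;
     -1, 1, -1, -1, 1, 1, -1, -1]

namespace SkewClifford

variable {V : Type} [AddCommGroup V] [Module ℝ V] {σ : ℝ} {B : V →ₗ[ℝ] V →ₗ[ℝ] ℝ}

lemma exists_isCyclicVector_one [Nontrivial V] {J : Fin 1 → V →ₗ[ℝ] V}
    (h : SkewClifford σ B J) :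
    ∃ v, IsCyclicVector σ B J (fun _ _ => -1) v := by
  obtain ⟨v, hv⟩ := h.exists_apply_self_ne_zero
  refine ⟨v, hv, fun a b => ?_⟩
  rw [Subsingleton.elim b a, h.sq, Subsingleton.elim (a ^^^ a) 0]
  simp

lemma exists_isCyclicVector_two [Nontrivial V] {J : Fin 2 → V →ₗ[ℝ] V}
    (h : SkewClifford σ B J) :
    ∃ v, IsCyclicVector σ B J !![-1, 1; -1, -1] v := by
  obtain ⟨v, hv⟩ := h.exists_apply_self_ne_zero
  refine ⟨v, hv, fun a b => ?_⟩
  fin_cases a <;> fin_cases b <;> simp [h.sort, h.sq]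

lemma exists_isCyclicVector_four [Nontrivial V] {J : Fin 4 → V →ₗ[ℝ] V}
    (h : SkewClifford σ B J) :
    ∃ v, IsCyclicVector σ B J !![-1, 1, 1, 1; -1, -1, 1, -1; -1, -1, -1, 1; -1, 1, -1, -1] v := by
  obtain ⟨v, hv⟩ := h.exists_apply_self_ne_zero
  obtain ⟨v, hv, hI⟩ := h.exists_fixed_cons (J 0 ∘ₗ J 1 ∘ₗ J 2 ∘ₗ J 3) 0 []
    (by simp [h.sort, h.sq, h.smul_smul_self]) (by simp [h.skew, h.sort])
    (by simp [h.sort, h.sq]) (by simp) (by simp) ⟨v, hv, by simp⟩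
  simp only [List.mem_cons, List.not_mem_nil, or_false, forall_eq, LinearMap.comp_apply] at hI
  obtain ⟨h1, h2, h3⟩ := h.triples 0 1 2 3 (by decide) (ε := 1)
    (by simpa using hI)
  refine ⟨v, hv, fun a b => ?_⟩
  fin_cases a <;> fin_cases b <;> simp [h.sort, h.sq, h1, h2, h3]

lemma exists_isCyclicVector_eight [Nontrivial V] {J : Fin 8 → V →ₗ[ℝ] V}
    (h : SkewClifford σ B J) :
    ∃ v, IsCyclicVector σ B J octonionSign v := by
  obtain ⟨v, hv⟩ := h.exists_apply_self_ne_zero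
  have hv := h.exists_fixed_cons (J 0 ∘ₗ J 1 ∘ₗ J 2 ∘ₗ J 3) 0 []
    (by simp [h.sort, h.sq, h.smul_smul_self]) (by simp [h.skew, h.sort])
    (by simp [h.sort, h.sq]) (by simp) (by simp) ⟨v, hv, by simp⟩
  have hv := h.exists_fixed_cons (J 0 ∘ₗ J 1 ∘ₗ J 4 ∘ₗ J 5) 4 _
    (by simp [h.sort, h.sq, h.smul_smul_self]) (by simp [h.skew, h.sort])
    (by simp [h.sort, h.sq]) (by simp [h.sort, h.sq]) (by simp [h.sort]) hv
  have hv := h.exists_fixed_cons (J 0 ∘ₗ J 2 ∘ₗ J 4 ∘ₗ J 6) 6 _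
    (by simp [h.sort, h.sq, h.smul_smul_self]) (by simp [h.skew, h.sort])
    (by simp [h.sort, h.sq]) (by simp [h.sort, h.sq]) (by simp [h.sort]) hv
  obtain ⟨v, hv, hI⟩ := h.exists_fixed_cons (J 0 ∘ₗ J 1 ∘ₗ J 6 ∘ₗ J 7) 7 _
    (by simp [h.sort, h.sq, h.smul_smul_self]) (by simp [h.skew, h.sort])
    (by simp [h.sort, h.sq]) (by simp [h.sort, h.sq]) (by simp [h.sort]) hv
  simp only [List.mem_cons, List.not_mem_nil, or_false, forall_eq_or_imp, forall_eq,
    LinearMap.comp_apply] at hI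
  obtain ⟨h0167, h0246, h0145, h0123⟩ := hI
  have h0347 : J 0 (J 3 (J 4 (J 7 v))) = -v := by
    conv_rhs => rw [← h0123, ← h0246, ← h0167]
    simp [h.sort, h.sq, h.smul_smul_self]
  have h0257 : J 0 (J 2 (J 5 (J 7 v))) = -v := by
    conv_rhs => rw [← h0145, ← h0246, ← h0167]
    simp [h.sort, h.sq, h.smul_smul_self]
  have h0356 : J 0 (J 3 (J 5 (J 6 v))) = -v := by
    conv_rhs => rw [← h0123, ← h0145, ← h0246]
    simp [h.sort, h.sq, h.smul_smul_self]
  have l1 := h.triples 0 1 2 3 (by decide) (ε := 1) (by simpa using h0123)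
  have l2 := h.triples 0 1 4 5 (by decide) (ε := 1) (by simpa using h0145)
  have l3 := h.triples 0 2 4 6 (by decide) (ε := 1) (by simpa using h0246)
  have l4 := h.triples 0 1 6 7 (by decide) (ε := 1) (by simpa using h0167)
  have l5 := h.triples 0 3 4 7 (by decide) (ε := -1) (by simpa using h0347)
  have l6 := h.triples 0 2 5 7 (by decide) (ε := -1) (by simpa using h0257)
  have l7 := h.triples 0 3 5 6 (by decide) (ε := -1) (by simpa using h0356)
  refine ⟨v, hv, fun a b => ?_⟩
  fin_cases a <;> fin_cases b <;>
    simp [h.sort, h.sq, l1, l2, l3, l4, l5, l6, l7, octonionSign]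

end SkewClifford

/-- The vectors `J a (J 0 v)` and `J a v`; these form a basis of a minimal module. -/
def cyclicFamily {r : ℕ} [NeZero r] {V : Type} [AddCommGroup V] [Module ℝ V]
    (J : Fin r → V →ₗ[ℝ] V) (v : V) : Fin r ⊕ Fin r → V :=
  Sum.elim (fun a => J a (J 0 v)) (fun a => J a v)

/-- The structure constants of the brackets in the basis `cyclicFamily`. -/
def bracketCoeff {r : ℕ} (t : Fin r → Fin r → ℝ) (a : Fin r) : Fin r ⊕ Fin r → Fin r ⊕ Fin r → ℝ
  | .inl _, .inl _ => 0
  | .inl b, .inr c => if a ^^^ b = c then t a b else 0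
  | .inr b, .inl c => if a ^^^ c = b then -t a c else 0
  | .inr _, .inr _ => 0

namespace SkewClifford

variable {r : ℕ} [NeZero r] {V : Type} [AddCommGroup V] [Module ℝ V] {σ : ℝ}
  {B : V →ₗ[ℝ] V →ₗ[ℝ] ℝ} {J : Fin r → V →ₗ[ℝ] V} {t : Fin r → Fin r → ℝ} {v : V}

lemma apply_inl_inr (h : SkewClifford σ B J) (hv : IsCyclicVector σ B J t v) (a b : Fin r) :
    B (J a (J 0 v)) (J b v) = 0 := by
  have h1 := h.skew b (J a (J 0 v)) v
  rw [hv.2] at h1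
  simp only [map_smul, LinearMap.smul_apply, h.apply_self] at h1
  simpa using h1

lemma apply_cyclicFamily_of_ne (h : SkewClifford σ B J) (hv : IsCyclicVector σ B J t v) :
    ∀ i j, i ≠ j → B (cyclicFamily J v i) (cyclicFamily J v j) = 0
  | .inl a, .inl b, hij => h.apply_ne (by simpa using hij) _
  | .inl a, .inr b, _ => h.apply_inl_inr hv a b
  | .inr a, .inl b, _ => (h.symm _ _).trans (h.apply_inl_inr hv b a)
  | .inr a, .inr b, hij => h.apply_ne (by simpa using hij) _

lemma apply_cyclicFamily_self_ne_zero (h : SkewClifford σ B J) (hv : IsCyclicVector σ B J t v) :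
    ∀ i, B (cyclicFamily J v i) (cyclicFamily J v i) ≠ 0 := by
  have hσ : σ ≠ 0 := left_ne_zero_of_mul_eq_one h.sign
  rintro (a | a)
  · simp [cyclicFamily, h.apply_same, hσ, hv.1]
  · simp [cyclicFamily, h.apply_same, hσ, hv.1]

lemma exists_apply_apply_eq (h : SkewClifford σ B J) (hv : IsCyclicVector σ B J t v)
    (a b : Fin r) : ∃ (s : ℝ) (c : Fin r), J a (J b v) = s • J c (J 0 v) := by
  by_cases hb : b = 0
  · exact ⟨1, a, by rw [hb, one_smul]⟩
  by_cases ha : a = 0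
  · exact ⟨-1, b, by rw [ha, h.anticomm 0 b (Ne.symm hb), neg_one_smul]⟩
  have h1 : J 0 (J a (J b v)) = (σ * t a b) • J (a ^^^ b) v := by
    rw [h.anticomm 0 a (Ne.symm ha), h.anticomm 0 b (Ne.symm hb), map_neg, neg_neg, hv.2]
  have h2 : J a (J b v) = -(t a b • J 0 (J (a ^^^ b) v)) := by
    have h3 := congrArg (J 0) h1
    rw [h.sq, map_smul, mul_smul] at h3
    rw [← h.smul_smul_self (J a (J b v)), ← neg_eq_iff_eq_neg.2 h3.symm, smul_neg,
      h.smul_smul_self]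
  by_cases hd : a ^^^ b = 0
  · exact ⟨-t a b, 0, by rw [h2, hd, neg_smul]⟩
  · exact ⟨t a b, a ^^^ b, by rw [h2, h.anticomm 0 _ (Ne.symm hd), smul_neg, neg_neg]⟩

lemma exists_apply_cyclicFamily_eq (h : SkewClifford σ B J) (hv : IsCyclicVector σ B J t v)
    (a : Fin r) : ∀ i, ∃ (s : ℝ) (j : _), J a (cyclicFamily J v i) = s • cyclicFamily J v j
  | .inl b => ⟨σ * t a b, .inr (a ^^^ b), hv.2 a b⟩
  | .inr b =>
    let ⟨s, c, hc⟩ := h.exists_apply_apply_eq hv a b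
    ⟨s, .inl c, hc⟩

lemma bracket_cyclicFamily (h : SkewClifford σ B J) (hv : IsCyclicVector σ B J t v)
    (a : Fin r) (i j : Fin r ⊕ Fin r) :
    B (J a (cyclicFamily J v i)) (cyclicFamily J v j) = B v v * bracketCoeff t a i j := by
  have key (b c : Fin r) :
      B (J a (J b (J 0 v))) (J c v) = B v v * if a ^^^ b = c then t a b else 0 := by
    rw [hv.2, map_smul, LinearMap.smul_apply, h.apply_apply]
    split_ifs
    · rw [smul_eq_mul]
      linear_combination (t a b * B v v) * h.sign
    · simp
  rcases i with b | b <;> rcases j with c | c <;> simp only [cyclicFamily, Sum.elim_inl,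
    Sum.elim_inr, bracketCoeff]
  · rw [hv.2, map_smul, LinearMap.smul_apply, h.symm, h.apply_inl_inr hv, smul_zero, mul_zero]
  · exact key b c
  · rw [h.skew, h.symm, key]
    split_ifs <;> simp
  · obtain ⟨s, d, hd⟩ := h.exists_apply_apply_eq hv a b
    rw [hd, map_smul, LinearMap.smul_apply, h.apply_inl_inr hv, smul_zero, mul_zero]

lemma linearIndependent_cyclicFamily (h : SkewClifford σ B J) (hv : IsCyclicVector σ B J t v) :
    LinearIndependent ℝ (cyclicFamily J v) := by
  rw [Fintype.linearIndependent_iff]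
  intro g hg i
  have h1 := congrArg (fun x => B x (cyclicFamily J v i)) hg
  simp only [map_sum, map_smul, LinearMap.sum_apply, LinearMap.smul_apply, map_zero,
    LinearMap.zero_apply, smul_eq_mul] at h1
  rw [Finset.sum_eq_single i (fun j _ hj => by rw [h.apply_cyclicFamily_of_ne hv j i hj, mul_zero])
    (by simp)] at h1
  exact (mul_eq_zero.1 h1).resolve_right (h.apply_cyclicFamily_self_ne_zero hv i)

lemma nondeg_span_cyclicFamily (h : SkewClifford σ B J) (hv : IsCyclicVector σ B J t v) {x : V}
    (hx : x ∈ Submodule.span ℝ (Set.range (cyclicFamily J v)))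
    (h0 : ∀ i, B x (cyclicFamily J v i) = 0) : x = 0 := by
  obtain ⟨g, rfl⟩ := (Submodule.mem_span_range_iff_exists_fun ℝ).1 hx
  refine Finset.sum_eq_zero fun i _ => ?_
  have h1 := h0 i
  simp only [map_sum, map_smul, LinearMap.sum_apply, LinearMap.smul_apply, smul_eq_mul] at h1
  rw [Finset.sum_eq_single i (fun j _ hj => by rw [h.apply_cyclicFamily_of_ne hv j i hj, mul_zero])
    (by simp)] at h1
  rw [(mul_eq_zero.1 h1).resolve_right (h.apply_cyclicFamily_self_ne_zero hv i), zero_smul]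

lemma apply_mem_span_cyclicFamily (h : SkewClifford σ B J) (hv : IsCyclicVector σ B J t v)
    (a : Fin r) {x : V} (hx : x ∈ Submodule.span ℝ (Set.range (cyclicFamily J v))) :
    J a x ∈ Submodule.span ℝ (Set.range (cyclicFamily J v)) := by
  suffices Submodule.span ℝ (Set.range (cyclicFamily J v)) ≤
      (Submodule.span ℝ (Set.range (cyclicFamily J v))).comap (J a) from this hx
  rw [Submodule.span_le]
  rintro _ ⟨i, rfl⟩
  obtain ⟨s, j, hj⟩ := h.exists_apply_cyclicFamily_eq hv a i
  simp only [Submodule.comap_coe, Set.mem_preimage, SetLike.mem_coe, hj]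
  exact Submodule.smul_mem _ _ (Submodule.subset_span ⟨j, rfl⟩)

end SkewClifford

/-- The endomorphism attached by `J` to the `a`-th vector of the standard basis. -/
def basisAction {r s n : ℕ} (hn : n = r + s) {V : Type} [AddCommGroup V] [Module ℝ V]
    (J : (Fin (r + s) → ℝ) →ₗ[ℝ] V →ₗ[ℝ] V) (a : Fin n) : V →ₗ[ℝ] V :=
  J (Pi.single (a.cast hn) 1)

section basisAction

variable {r s n : ℕ} {V : Type} [AddCommGroup V] [Module ℝ V] {σ : ℝ} {B : V →ₗ[ℝ] V →ₗ[ℝ] ℝ}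
  {J : (Fin (r + s) → ℝ) →ₗ[ℝ] V →ₗ[ℝ] V}

lemma skewClifford_basisAction (hn : n = r + s) (hσ : σ * σ = 1)
    (hs : ∀ Z W, sform r s Z W = σ * ∑ i, Z i * W i) (h : IsAdmissible r s V B J) :
    SkewClifford σ B (basisAction hn J) := by
  obtain ⟨-, -, hsymm, hnd, hsq, hskew⟩ := h
  have hsq' (a : Fin n) (x : V) : basisAction hn J a (basisAction hn J a x) = -(σ • x) := by
    simp [basisAction, hsq, hs, Pi.single_apply]
  refine ⟨hσ, hsymm, hnd, hsq', fun a b hab x => ?_, fun a => hskew _⟩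
  have h1 := hsq (Pi.single (a.cast hn) 1 + Pi.single (b.cast hn) 1) x
  have h2 : sform r s (Pi.single (a.cast hn) 1 + Pi.single (b.cast hn) 1)
      (Pi.single (a.cast hn) 1 + Pi.single (b.cast hn) 1) = σ + σ := by
    have hab' : a.cast hn ≠ b.cast hn := by simpa using hab
    simp [hs, Pi.single_apply, mul_add, Finset.sum_add_distrib, hab', hab'.symm]
  have h3 := hsq' a x
  have h4 := hsq' b x
  simp only [h2, map_add, LinearMap.add_apply, neg_smul, add_smul] at h1
  simp only [basisAction] at h3 h4 ⊢
  rw [h3, h4] at h1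
  rw [eq_neg_iff_add_eq_zero]
  rw [← sub_eq_zero] at h1
  rw [← h1]
  abel

lemma apply_mem_of_basisAction_mem (hn : n = r + s) {W : Submodule ℝ V}
    (hW : ∀ a, ∀ x ∈ W, basisAction hn J a x ∈ W) (Z : Fin (r + s) → ℝ) {x : V} (hx : x ∈ W) :
    J Z x ∈ W := by
  subst hn
  rw [pi_eq_sum_univ' Z]
  simp only [map_sum, map_smul, LinearMap.sum_apply, LinearMap.smul_apply]
  refine Submodule.sum_mem _ fun a _ => Submodule.smul_mem _ _ ?_
  convert hW a x hx using 2
  simp only [basisAction, Fin.cast_refl, id_eq]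

lemma IsMinimalAdmissible.eq_top (h : IsMinimalAdmissible r s V B J) {W : Submodule ℝ V}
    (hW : ∀ Z, ∀ x ∈ W, J Z x ∈ W) (h0 : W ≠ ⊥) (hB : ∀ x ∈ W, (∀ y ∈ W, B x y = 0) → x = 0) :
    W = ⊤ := by
  obtain ⟨⟨hfin, -, hsymm, -, hsq, hskew⟩, hmin⟩ := h
  let J' : (Fin (r + s) → ℝ) →ₗ[ℝ] W →ₗ[ℝ] W :=
    LinearMap.mk₂ ℝ (fun Z x => ⟨J Z x, hW Z x x.2⟩)
      (fun _ _ _ => by ext; simp) (fun _ _ _ => by ext; simp)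
      (fun _ _ _ => by ext; simp) (fun _ _ _ => by ext; simp)
  have hadm : IsAdmissible r s W (B.compl₁₂ W.subtype W.subtype) J' := by
    refine ⟨inferInstance, Submodule.nontrivial_iff_ne_bot.2 h0, fun x y => hsymm x y,
      fun x hx => Subtype.ext (hB x x.2 fun y hy => hx ⟨y, hy⟩),
      fun Z x => Subtype.ext (hsq Z x), fun Z x y => hskew Z x y⟩
  exact Submodule.eq_top_of_finrank_eq (le_antisymm W.finrank_le (hmin _ _ _ hadm))

end basisAction

lemma IsMinimalAdmissible.exists_basis {r s n : ℕ} [NeZero n] {V : Type} [AddCommGroup V]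
    [Module ℝ V] {σ : ℝ} {B : V →ₗ[ℝ] V →ₗ[ℝ] ℝ} {J : (Fin (r + s) → ℝ) →ₗ[ℝ] V →ₗ[ℝ] V}
    (h : IsMinimalAdmissible r s V B J) (hn : n = r + s)
    (hJ : SkewClifford σ B (basisAction hn J)) {t : Fin n → Fin n → ℝ}
    (hv : ∃ v, IsCyclicVector σ B (basisAction hn J) t v) :
    ∃ (e : Module.Basis (Fin n ⊕ Fin n) ℝ V) (ε : ℝ), ε ≠ 0 ∧
      ∀ a i j, B (basisAction hn J a (e i)) (e j) = ε * bracketCoeff t a i j := by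
  obtain ⟨v, hv⟩ := hv
  have htop : Submodule.span ℝ (Set.range (cyclicFamily (basisAction hn J) v)) = ⊤ := by
    refine h.eq_top (fun Z x hx => apply_mem_of_basisAction_mem hn
      (fun a x hx => hJ.apply_mem_span_cyclicFamily hv a hx) Z hx) ?_ fun x hx h0 =>
        hJ.nondeg_span_cyclicFamily hv hx fun i => h0 _ (Submodule.subset_span ⟨i, rfl⟩)
    rw [Submodule.ne_bot_iff]
    exact ⟨_, Submodule.subset_span ⟨.inl 0, rfl⟩,
      (hJ.linearIndependent_cyclicFamily hv).ne_zero _⟩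
  refine ⟨.mk (hJ.linearIndependent_cyclicFamily hv) htop.ge, B v v, hv.1, fun a i j => ?_⟩
  rw [Module.Basis.mk_apply, Module.Basis.mk_apply]
  exact hJ.bracket_cyclicFamily hv a i j

/-- For each of the four ranks the signs of a cyclic vector can be chosen independently of the
module and of the signature. -/
lemma exists_isCyclicVector {r : ℕ} [NeZero r] (hr : r = 1 ∨ r = 2 ∨ r = 4 ∨ r = 8) :
    ∃ t : Fin r → Fin r → ℝ, ∀ (V : Type) [AddCommGroup V] [Module ℝ V] [Nontrivial V] (σ : ℝ)
      (B : V →ₗ[ℝ] V →ₗ[ℝ] ℝ) (J : Fin r → V →ₗ[ℝ] V), SkewClifford σ B J →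
        ∃ v, IsCyclicVector σ B J t v := by
  rcases hr with rfl | rfl | rfl | rfl
  · exact ⟨_, fun _ _ _ _ _ _ _ h => h.exists_isCyclicVector_one⟩
  · exact ⟨_, fun _ _ _ _ _ _ _ h => h.exists_isCyclicVector_two⟩
  · exact ⟨_, fun _ _ _ _ _ _ _ h => h.exists_isCyclicVector_four⟩
  · exact ⟨_, fun _ _ _ _ _ _ _ h => h.exists_isCyclicVector_eight⟩

lemma sform_zero_right (r : ℕ) (Z W : Fin (r + 0) → ℝ) :
    sform r 0 Z W = 1 * ∑ i, Z i * W i := by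
  rw [sform, one_mul]
  exact Finset.sum_congr rfl fun i _ => by rw [if_pos (by have := i.2; omega), one_mul]

lemma sform_zero_left (s : ℕ) (Z W : Fin (0 + s) → ℝ) :
    sform 0 s Z W = -1 * ∑ i, Z i * W i := by
  rw [sform, Finset.mul_sum]
  exact Finset.sum_congr rfl fun i _ => by rw [if_neg (by omega), mul_assoc]

lemma IsHBracket.apply_cast {r s n : ℕ} {V : Type} [AddCommGroup V] [Module ℝ V] {σ : ℝ}
    {B : V →ₗ[ℝ] V →ₗ[ℝ] ℝ} {J : (Fin (r + s) → ℝ) →ₗ[ℝ] V →ₗ[ℝ] V}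
    {br : V →ₗ[ℝ] V →ₗ[ℝ] (Fin (r + s) → ℝ)} (h : IsHBracket r s V B J br) (hn : n = r + s)
    (hσ : σ * σ = 1) (hs : ∀ Z W, sform r s Z W = σ * ∑ i, Z i * W i) (a : Fin n) (x y : V) :
    br x y (a.cast hn) = σ * B (basisAction hn J a x) y := by
  rw [basisAction, ← h, hs]
  simp [Pi.single_apply, ← mul_assoc, hσ]

theorem stmt4 (r : ℕ) (hr : r = 1 ∨ r = 2 ∨ r = 4 ∨ r = 8)
    (V1 : Type) [AddCommGroup V1] [Module ℝ V1]
    (B1 : V1 →ₗ[ℝ] V1 →ₗ[ℝ] ℝ)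
    (J1 : (Fin (r + 0) → ℝ) →ₗ[ℝ] V1 →ₗ[ℝ] V1)
    (br1 : V1 →ₗ[ℝ] V1 →ₗ[ℝ] (Fin (r + 0) → ℝ))
    (hadm1 : IsMinimalAdmissible r 0 V1 B1 J1)
    (hbr1 : IsHBracket r 0 V1 B1 J1 br1)
    (V2 : Type) [AddCommGroup V2] [Module ℝ V2]
    (B2 : V2 →ₗ[ℝ] V2 →ₗ[ℝ] ℝ)
    (J2 : (Fin (0 + r) → ℝ) →ₗ[ℝ] V2 →ₗ[ℝ] V2)
    (br2 : V2 →ₗ[ℝ] V2 →ₗ[ℝ] (Fin (0 + r) → ℝ))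
    (hadm2 : IsMinimalAdmissible 0 r V2 B2 J2)
    (hbr2 : IsHBracket 0 r V2 B2 J2 br2)
    :
    ∃ f : (V1 × (Fin (r + 0) → ℝ)) ≃ₗ[ℝ] (V2 × (Fin (0 + r) → ℝ)),
      IsLieIso br1 br2 f := by
  have : NeZero r := ⟨by omega⟩
  obtain ⟨t, ht⟩ := exists_isCyclicVector hr
  have hn1 : r = r + 0 := (Nat.add_zero r).symm
  have hn2 : r = 0 + r := (Nat.zero_add r).symm
  have hs1 : (1 : ℝ) * 1 = 1 := by norm_num
  have hs2 : (-1 : ℝ) * -1 = 1 := by norm_num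
  have := hadm1.1.2.1
  have := hadm2.1.2.1
  have hJ1 := skewClifford_basisAction hn1 hs1 (sform_zero_right r) hadm1.1
  have hJ2 := skewClifford_basisAction hn2 hs2 (sform_zero_left r) hadm2.1
  obtain ⟨e1, ε1, hε1, he1⟩ := hadm1.exists_basis hn1 hJ1 (ht _ _ _ _ hJ1)
  obtain ⟨e2, ε2, hε2, he2⟩ := hadm2.exists_basis hn2 hJ2 (ht _ _ _ _ hJ2)
  have hκ : -(ε2 / ε1) ≠ 0 := neg_ne_zero.2 (div_ne_zero hε2 hε1)
  let F : V1 ≃ₗ[ℝ] V2 := e1.equiv e2 (Equiv.refl _)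
  let C : (Fin (r + 0) → ℝ) ≃ₗ[ℝ] (Fin (0 + r) → ℝ) :=
    (LinearEquiv.funCongrLeft ℝ ℝ (finCongr (hn2.symm.trans hn1))).trans
      (LinearEquiv.smulOfNeZero ℝ _ _ hκ)
  have key (a : Fin r) : (B2 ∘ₗ basisAction hn2 J2 a).compl₁₂ F.toLinearMap F.toLinearMap =
      (ε2 / ε1) • (B1 ∘ₗ basisAction hn1 J1 a) := by
    refine e1.ext fun i => e1.ext fun j => ?_
    simp [F, he1, he2]
    field_simp
  refine ⟨F.prodCongr C, fun x y => Prod.ext (map_zero F) (funext fun a => ?_)⟩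
  obtain ⟨a, rfl⟩ : ∃ b : Fin r, b.cast hn2 = a := ⟨a.cast hn2.symm, rfl⟩
  have h1 := hbr1.apply_cast hn1 hs1 (sform_zero_right r) a x.1 y.1
  have h2 := hbr2.apply_cast hn2 hs2 (sform_zero_left r) a (F x.1) (F y.1)
  have h3 := LinearMap.congr_fun₂ (key a) x.1 y.1
  change -(ε2 / ε1) * br1 x.1 y.1 (a.cast hn1) = br2 (F x.1) (F y.1) (a.cast hn2)
  change B2 (basisAction hn2 J2 a (F x.1)) (F y.1) =
    (ε2 / ε1) * B1 (basisAction hn1 J1 a x.1) y.1 at h3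
  rw [h1, h2, h3]
  ring
end

section
/- For every integer r ≥ 1, a pseudo H-type Lie algebra n_{r,0} built on a minimal admissible Cl_{r,0}-module is isomorphic as a Lie algebra to a pseudo H-type Lie algebra n_{0,r} built on a minimal admissible Cl_{0,r}-module if and only if r ≡ 0, 1, 2, or 4 (mod 8). -/
open Matrix

/-- A family of pairwise anticommuting matrices with common square `ε`. -/
structure IsCliffordFamily {ι κ : Type} [Fintype κ] [DecidableEq κ] (ε : ℝ)
    (J : ι → Matrix κ κ ℝ) : Prop where
  sq : ∀ i, J i * J i = ε • (1 : Matrix κ κ ℝ)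
  anti : ∀ i j, i ≠ j → J i * J j = -(J j * J i)

namespace IsCliffordFamily

variable {ι κ : Type} [Fintype κ] [DecidableEq κ] {ε : ℝ} {J : ι → Matrix κ κ ℝ}

lemma transpose (h : IsCliffordFamily ε J) : IsCliffordFamily ε (fun i => (J i)ᵀ) where
  sq i := by rw [← transpose_mul, h.sq]; simp
  anti i j hij := by rw [← transpose_mul, h.anti j i hij.symm, ← transpose_mul]; simp

lemma comp (h : IsCliffordFamily ε J) {ι' : Type} {e : ι' → ι} (he : e.Injective) :
    IsCliffordFamily ε (fun i => J (e i)) where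
  sq _ := h.sq _
  anti _ _ hij := h.anti _ _ (he.ne hij)

end IsCliffordFamily

/-- The sum of `L_s * X * R_sᵀ` over all ordered monomials `s` in the indices `l`. -/
def cliffordAverage {ι κ κ' : Type} [Fintype κ] [Fintype κ']
    (L : ι → Matrix κ κ ℝ) (R : ι → Matrix κ' κ' ℝ) (X : Matrix κ κ' ℝ) :
    List ι → Matrix κ κ' ℝ
  | [] => X
  | i :: l => cliffordAverage L R X l + L i * cliffordAverage L R X l * (R i)ᵀ

lemma cliffordAverage_invariant {ι κ κ' : Type} [Fintype κ] [Fintype κ'] [DecidableEq κ]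
    [DecidableEq κ'] {ε : ℝ} (hε : ε * ε = 1)
    {L : ι → Matrix κ κ ℝ} {R : ι → Matrix κ' κ' ℝ}
    (hL : IsCliffordFamily ε L) (hR : IsCliffordFamily ε R) (X : Matrix κ κ' ℝ)
    (l : List ι) {j : ι} (hj : j ∈ l) :
    L j * cliffordAverage L R X l * (R j)ᵀ = cliffordAverage L R X l := by
  have hR' := hR.transpose
  induction l with
  | nil => simp at hj
  | cons i l ih =>
    simp only [cliffordAverage]
    set Y := cliffordAverage L R X l with hY
    by_cases hij : j = i
    · subst hij
      have : L j * (L j * Y * (R j)ᵀ) * (R j)ᵀ = (L j * L j) * Y * ((R j)ᵀ * (R j)ᵀ) := by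
        simp only [Matrix.mul_assoc]
      rw [Matrix.mul_add, Matrix.add_mul, this, hL.sq, hR'.sq]
      simp [smul_smul, hε, add_comm]
    · have hjl : j ∈ l := by simpa [hij] using hj
      have h1 := ih hjl
      have : L j * (L i * Y * (R i)ᵀ) * (R j)ᵀ = (L j * L i) * Y * ((R i)ᵀ * (R j)ᵀ) := by
        simp only [Matrix.mul_assoc]
      have h2 : L i * L j * Y * ((R j)ᵀ * (R i)ᵀ) = L i * (L j * Y * (R j)ᵀ) * (R i)ᵀ := by
        simp only [Matrix.mul_assoc]
      rw [Matrix.mul_add, Matrix.add_mul, this, hL.anti j i hij,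
        hR'.anti i j (Ne.symm hij)]
      simp only [Matrix.neg_mul, Matrix.mul_neg, neg_neg]
      rw [h2, h1]

/-- The ordered product of the `J i` along a list of indices. -/
def monomialProd {ι κ : Type} [Fintype κ] [DecidableEq κ] (J : ι → Matrix κ κ ℝ) (s : List ι) :
    Matrix κ κ ℝ := (s.map J).prod

@[simp] lemma monomialProd_nil {ι κ : Type} [Fintype κ] [DecidableEq κ]
    (J : ι → Matrix κ κ ℝ) : monomialProd J [] = 1 := rfl

@[simp] lemma monomialProd_cons {ι κ : Type} [Fintype κ] [DecidableEq κ]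
    (J : ι → Matrix κ κ ℝ) (i : ι) (s : List ι) :
    monomialProd J (i :: s) = J i * monomialProd J s := by simp [monomialProd]

lemma cliffordAverage_eq_sum {ι κ κ' : Type} [Fintype κ] [Fintype κ'] [DecidableEq κ]
    [DecidableEq κ'] (L : ι → Matrix κ κ ℝ) (R : ι → Matrix κ' κ' ℝ) (X : Matrix κ κ' ℝ)
    (l : List ι) :
    cliffordAverage L R X l =
      (l.sublists'.map fun s => monomialProd L s * X * (monomialProd R s)ᵀ).sum := by
  induction l with
  | nil => simp [cliffordAverage]
  | cons i l ih =>
    simp only [cliffordAverage, List.sublists'_cons, List.map_append, List.sum_append,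
      List.map_map, ih]
    congr 1
    induction l.sublists' with
    | nil => simp
    | cons s ss ihs =>
      simp only [List.map_cons, List.sum_cons, Matrix.mul_add, Matrix.add_mul, ihs]
      simp [Matrix.mul_assoc]

/-- The sign by which the square of a product of `k` anticommuting square roots of `-1`
differs from `1`. -/
def reversalSign : ℕ → ℝ
  | 0 => 1
  | k + 1 => -(-1) ^ k * reversalSign k

lemma reversalSign_add_two (k : ℕ) : reversalSign (k + 2) = -reversalSign k := by
  simp only [reversalSign, pow_succ]
  have : ((-1 : ℝ) ^ k) * (-1) ^ k = 1 := by rw [← mul_pow]; simp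
  linear_combination (-reversalSign k) * this

lemma reversalSign_add_four_mul (k q : ℕ) : reversalSign (4 * q + k) = reversalSign k := by
  induction q with
  | zero => simp
  | succ q ih =>
    rw [show 4 * (q + 1) + k = (4 * q + k) + 2 + 2 by ring, reversalSign_add_two,
      reversalSign_add_two, ih, neg_neg]

lemma reversalSign_mod (k : ℕ) : reversalSign k = reversalSign (k % 4) := by
  conv_lhs => rw [← Nat.div_add_mod k 4]
  exact reversalSign_add_four_mul _ _

/-- A skew-symmetric matrix representation of the Clifford algebra `Cl_{n,0}`, `n = #ι`. -/
structure IsCliffordSystem {ι κ : Type} [Fintype κ] [DecidableEq κ]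
    (J : ι → Matrix κ κ ℝ) : Prop extends IsCliffordFamily (-1) J where
  skew : ∀ i, (J i)ᵀ = -J i

namespace IsCliffordSystem

variable {ι κ : Type} [Fintype κ] [DecidableEq κ] {J : ι → Matrix κ κ ℝ}

lemma mul_self (h : IsCliffordSystem J) (i : ι) : J i * J i = -1 := by simpa using h.sq i

lemma mul_monomialProd (h : IsCliffordSystem J) {j : ι} (s : List ι) (hj : j ∉ s) :
    J j * monomialProd J s = (-1 : ℝ) ^ s.length • (monomialProd J s * J j) := by
  induction s with
  | nil => simp
  | cons i s ih =>
    simp only [List.mem_cons, not_or] at hj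
    rw [monomialProd_cons, ← Matrix.mul_assoc, h.anti j i hj.1, Matrix.neg_mul,
      Matrix.mul_assoc, ih hj.2]
    simp [pow_succ, Matrix.mul_assoc]

lemma transpose_monomialProd (h : IsCliffordSystem J) (s : List ι) (hs : s.Nodup) :
    (monomialProd J s)ᵀ = reversalSign s.length • monomialProd J s := by
  induction s with
  | nil => simp [reversalSign]
  | cons i s ih =>
    rw [List.nodup_cons] at hs
    have := h.mul_monomialProd s hs.1
    rw [monomialProd_cons, transpose_mul, ih hs.2, h.skew, this]
    have h2 : ((-1 : ℝ) ^ s.length) * (-1) ^ s.length = 1 := by rw [← mul_pow]; simp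
    simp only [List.length_cons, reversalSign, smul_smul, Matrix.mul_neg, Matrix.smul_mul]
    rw [← smul_neg, smul_neg, ← neg_smul]
    congr 1
    linear_combination (reversalSign s.length) * h2

lemma monomialProd_mul_self (h : IsCliffordSystem J) (s : List ι) (hs : s.Nodup) :
    monomialProd J s * monomialProd J s = reversalSign s.length • (1 : Matrix κ κ ℝ) := by
  induction s with
  | nil => simp [reversalSign]
  | cons i s ih =>
    rw [List.nodup_cons] at hs
    have := h.mul_monomialProd s hs.1
    rw [monomialProd_cons]
    nth_rewrite 1 [this]
    rw [Matrix.smul_mul, Matrix.mul_assoc, ← Matrix.mul_assoc (J i), h.mul_self]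
    simp only [List.length_cons, reversalSign, Matrix.mul_neg, Matrix.one_mul,
      ih hs.2, smul_smul, smul_neg, neg_mul, neg_smul]

lemma anticomm_monomialProd (h : IsCliffordSystem J) (s : List ι) (hs : s.Nodup)
    (he : Even s.length) {j : ι} (hj : j ∈ s) :
    J j * monomialProd J s = -(monomialProd J s * J j) := by
  suffices H : ∀ s : List ι, s.Nodup → j ∈ s →
      J j * monomialProd J s = -(-1 : ℝ) ^ s.length • (monomialProd J s * J j) by
    rw [H s hs hj, he.neg_one_pow]; simp
  intro s hs hj
  induction s with
  | nil => simp at hj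
  | cons i s ih =>
    rw [List.nodup_cons] at hs
    by_cases hij : j = i
    · subst hij
      rw [monomialProd_cons, Matrix.mul_assoc (J j) (monomialProd J s)]
      nth_rewrite 1 [h.mul_monomialProd s hs.1]
      simp [pow_succ]
    · have hjs : j ∈ s := by simpa [hij] using hj
      rw [monomialProd_cons, ← Matrix.mul_assoc, h.anti j i hij, Matrix.neg_mul,
        Matrix.mul_assoc, ih hs.2 hjs]
      simp [pow_succ, Matrix.mul_assoc]

lemma trace_monomialProd [Fintype ι] (h : IsCliffordSystem J) (hι : Fintype.card ι % 4 ≠ 3)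
    (s : List ι) (hs : s.Nodup) (hne : s ≠ []) : (monomialProd J s).trace = 0 := by
  have hT := congrArg Matrix.trace (h.transpose_monomialProd s hs)
  rw [trace_transpose, trace_smul, smul_eq_mul, reversalSign_mod] at hT
  have h4 : s.length % 4 < 4 := Nat.mod_lt _ (by norm_num)
  have hcase : s.length % 4 = 0 ∨ s.length % 4 = 1 ∨ s.length % 4 = 2 ∨ s.length % 4 = 3 := by
    omega
  rcases hcase with h0 | h0 | h0 | h0
  · obtain ⟨i, t, rfl⟩ := List.exists_cons_of_ne_nil hne
    have ht := h.mul_monomialProd t (List.nodup_cons.1 hs).1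
    have hodd : Odd t.length := by
      rw [List.length_cons] at h0; rw [Nat.odd_iff]; omega
    rw [hodd.neg_one_pow] at ht
    have := congrArg Matrix.trace ht
    rw [trace_smul, trace_mul_comm (monomialProd J t)] at this
    rw [monomialProd_cons]
    simp only [smul_eq_mul] at this
    linarith
  · rw [h0] at hT; norm_num [reversalSign] at hT; linarith
  · rw [h0] at hT; norm_num [reversalSign] at hT; linarith
  · obtain ⟨j, hj⟩ : ∃ j, j ∉ s := by
      by_contra! hall
      apply hι
      classical
      have : s.toFinset = Finset.univ := by ext; simp [hall]
      rw [← Finset.card_univ, ← this, List.toFinset_card_of_nodup hs, h0]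
    have ht := h.mul_monomialProd s hj
    have hodd : Odd s.length := by rw [Nat.odd_iff]; omega
    rw [hodd.neg_one_pow] at ht
    have h1 := congrArg (fun X => Matrix.trace (J j * X)) ht
    rw [← Matrix.mul_assoc, h.mul_self, Matrix.mul_smul, trace_smul, ← Matrix.mul_assoc,
      trace_mul_comm (J j * monomialProd J s), ← Matrix.mul_assoc, h.mul_self] at h1
    simp at h1
    linarith

end IsCliffordSystem

/-- The sum of `reversalSign (k + #s)` over the subsets `s` of an `n`-element set. -/
def reversalSum : ℕ → ℕ → ℝ
  | 0, k => reversalSign k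
  | n + 1, k => reversalSum n k + reversalSum n (k + 1)

lemma reversalSum_add_two_right (n k : ℕ) : reversalSum n (k + 2) = -reversalSum n k := by
  induction n generalizing k with
  | zero => exact reversalSign_add_two k
  | succ n ih =>
    simp only [reversalSum]
    rw [ih, show k + 2 + 1 = (k + 1) + 2 by ring, ih]
    ring

lemma reversalSum_add_two_left (n k : ℕ) :
    reversalSum (n + 2) k = 2 * reversalSum n (k + 1) := by
  simp only [reversalSum]
  rw [show k + 1 + 1 = k + 2 by ring, reversalSum_add_two_right]
  ring

lemma reversalSum_add_four (n k : ℕ) : reversalSum (n + 4) k = -4 * reversalSum n k := by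
  rw [show n + 4 = (n + 2) + 2 by ring, reversalSum_add_two_left, reversalSum_add_two_left,
    show k + 1 + 1 = k + 2 by ring, reversalSum_add_two_right]
  ring

lemma reversalSum_add_eight_mul (n q : ℕ) :
    reversalSum (8 * q + n) 0 = 16 ^ q * reversalSum n 0 := by
  induction q with
  | zero => simp
  | succ q ih =>
    rw [show 8 * (q + 1) + n = (8 * q + n) + 4 + 4 by ring, reversalSum_add_four,
      reversalSum_add_four, ih]
    ring

lemma sum_sublists'_reversalSign {ι : Type} (l : List ι) (k : ℕ) :
    (l.sublists'.map fun s => reversalSign (k + s.length)).sum = reversalSum l.length k := by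
  induction l generalizing k with
  | nil => simp [reversalSum]
  | cons i l ih =>
    simp only [List.sublists'_cons, List.map_append, List.sum_append, List.map_map,
      List.length_cons, reversalSum, ih, Function.comp_def]
    congr 1
    rw [← ih]
    simp only [add_assoc, add_comm 1]

lemma sum_sublists'_eq_nil {ι : Type} (l : List ι) (f : List ι → ℝ)
    (hf : ∀ s, s.Sublist l → s ≠ [] → f s = 0) : (l.sublists'.map f).sum = f [] := by
  induction l with
  | nil => simp
  | cons i l ih =>
    rw [List.sublists'_cons, List.map_append, List.sum_append,
      ih fun s hs => hf s (hs.trans (List.sublist_cons_self i l)), add_eq_left]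
    refine List.sum_eq_zero fun x hx => ?_
    simp only [List.map_map, List.mem_map, List.mem_sublists', Function.comp_apply] at hx
    obtain ⟨s, hs, rfl⟩ := hx
    exact hf _ (hs.cons_cons i) (by simp)

lemma sum_single_conj {κ κ' : Type} [Fintype κ] [Fintype κ'] [DecidableEq κ] [DecidableEq κ']
    (M : Matrix κ κ ℝ) (M' : Matrix κ' κ' ℝ) :
    ∑ a, ∑ b, (M * single a b (1 : ℝ) * M'ᵀ : Matrix κ κ' ℝ) a b = M.trace * M'.trace := by
  have (a : κ) (b : κ') : (M * single a b (1 : ℝ) * M'ᵀ : Matrix κ κ' ℝ) a b = M a a * M' b b := by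
    simp [Matrix.mul_apply, Matrix.single_apply, Finset.sum_ite_eq, ite_and]
  simp only [this, Matrix.trace, Matrix.diag, Finset.sum_mul_sum]

lemma sum_single_conj_transpose {κ : Type} [Fintype κ] [DecidableEq κ] (M : Matrix κ κ ℝ) :
    ∑ a, ∑ b, (M * single a b (1 : ℝ) * Mᵀ : Matrix κ κ ℝ) b a = (M * M).trace := by
  have (a b : κ) : (M * single a b (1 : ℝ) * Mᵀ : Matrix κ κ ℝ) b a = M a b * M b a := by
    simp [Matrix.mul_apply, Matrix.single_apply, Finset.sum_ite_eq, ite_and, mul_comm]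
  simp only [this, Matrix.trace, Matrix.diag, Matrix.mul_apply]

lemma sum_sum_list_sum {κ κ' σ : Type} [Fintype κ] [Fintype κ'] (ss : List σ)
    (f : σ → κ → κ' → ℝ) :
    ∑ a, ∑ b, (ss.map fun s => f s a b).sum = (ss.map fun s => ∑ a, ∑ b, f s a b).sum := by
  induction ss with
  | nil => simp
  | cons s ss ih => simp [Finset.sum_add_distrib, ih]

lemma cliffordAverage_apply {ι κ κ' : Type} [Fintype κ] [Fintype κ'] [DecidableEq κ]
    [DecidableEq κ'] (L : ι → Matrix κ κ ℝ) (R : ι → Matrix κ' κ' ℝ) (X : Matrix κ κ' ℝ)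
    (l : List ι) (a : κ) (b : κ') :
    cliffordAverage L R X l a b =
      (l.sublists'.map fun s => (monomialProd L s * X * (monomialProd R s)ᵀ) a b).sum := by
  rw [cliffordAverage_eq_sum]
  induction l.sublists' with
  | nil => simp
  | cons s ss ih => simp [ih]

namespace IsCliffordSystem

variable {ι κ κ' : Type} [Fintype ι] [Fintype κ] [DecidableEq κ]
  [Fintype κ'] [DecidableEq κ'] {J : ι → Matrix κ κ ℝ} {J' : ι → Matrix κ' κ' ℝ}

lemma sum_average_single (J' : ι → Matrix κ' κ' ℝ) (h : IsCliffordSystem J)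
    (hι : Fintype.card ι % 4 ≠ 3) :
    ∑ a, ∑ b, cliffordAverage J J' (single a b (1 : ℝ)) Finset.univ.toList a b =
      Fintype.card κ * Fintype.card κ' := by
  simp only [cliffordAverage_apply, sum_sum_list_sum, sum_single_conj]
  rw [sum_sublists'_eq_nil _ (fun s => (monomialProd J s).trace * (monomialProd J' s).trace)]
  · simp
  · intro s hs hne
    rw [h.trace_monomialProd hι s (hs.nodup (Finset.nodup_toList _)) hne, zero_mul]

lemma sum_average_single_transpose (h : IsCliffordSystem J) :
    ∑ a, ∑ b, cliffordAverage J J (single a b (1 : ℝ)) Finset.univ.toList b a =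
      Fintype.card κ * reversalSum (Fintype.card ι) 0 := by
  simp only [cliffordAverage_apply, sum_sum_list_sum, sum_single_conj_transpose]
  have : ((Finset.univ : Finset ι).toList.sublists'.map
      fun s => (monomialProd J s * monomialProd J s).trace) =
      (Finset.univ : Finset ι).toList.sublists'.map
        fun s => Fintype.card κ * reversalSign (0 + s.length) := by
    refine List.map_congr_left fun s hs => ?_
    rw [List.mem_sublists'] at hs
    rw [h.monomialProd_mul_self s (hs.nodup (Finset.nodup_toList _))]
    simp [mul_comm]
  rw [this, List.sum_map_mul_left, sum_sublists'_reversalSign]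
  simp

/-- An averaged matrix intertwines the two systems. -/
lemma average_intertwines (h : IsCliffordSystem J) (h' : IsCliffordSystem J')
    (X : Matrix κ κ' ℝ) (i : ι) :
    J i * cliffordAverage J J' X Finset.univ.toList =
      cliffordAverage J J' X Finset.univ.toList * J' i := by
  have := cliffordAverage_invariant (by norm_num) h.toIsCliffordFamily h'.toIsCliffordFamily X
    Finset.univ.toList (j := i) (by simp)
  set Y := cliffordAverage J J' X Finset.univ.toList
  rw [h'.skew] at this
  have h1 := congrArg (· * J' i) this
  simp only [Matrix.mul_neg, Matrix.neg_mul] at h1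
  rw [Matrix.mul_assoc, h'.mul_self] at h1
  simpa using h1

/-- Only scalar matrices are symmetric and commute with the system. -/
def IsSymmIrreducible (J : ι → Matrix κ κ ℝ) : Prop :=
  ∀ T : Matrix κ κ ℝ, Tᵀ = T → (∀ i, J i * T = T * J i) → ∃ c : ℝ, T = c • (1 : Matrix κ κ ℝ)

/-- The Frobenius–Schur count for an irreducible representation of `Cl_{n,0}`. -/
lemma card_equation [Nonempty κ] (h : IsCliffordSystem J) (hι : Fintype.card ι % 4 ≠ 3)
    (hirr : IsSymmIrreducible J) :
    (Fintype.card κ : ℝ) * Fintype.card κ + Fintype.card κ * reversalSum (Fintype.card ι) 0 =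
      2 ^ (Fintype.card ι + 1) := by
  rw [← sum_average_single J h hι, ← h.sum_average_single_transpose, ← Finset.sum_add_distrib]
  simp only [← Finset.sum_add_distrib]
  set P : Matrix κ κ ℝ → Matrix κ κ ℝ :=
    fun X => cliffordAverage J J X Finset.univ.toList with hP
  have key (X : Matrix κ κ ℝ) : ∃ c : ℝ, P X + (P X)ᵀ = c • (1 : Matrix κ κ ℝ) := by
    refine hirr _ (by simp [add_comm]) fun i => ?_
    have h1 := h.average_intertwines h X i
    have h2 := congrArg Matrix.transpose h1
    simp only [transpose_mul, h.skew, Matrix.mul_neg, Matrix.neg_mul, neg_inj] at h2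
    rw [Matrix.mul_add, Matrix.add_mul, h1, h2]
  obtain ⟨o⟩ := ‹Nonempty κ›
  have hoff (X : Matrix κ κ ℝ) (a b : κ) :
      P X a b + P X b a = if a = b then P X o o + P X o o else 0 := by
    obtain ⟨c, hc⟩ := key X
    have h1 := congrFun (congrFun hc a) b
    have h2 := congrFun (congrFun hc o) o
    simp only [Matrix.add_apply, transpose_apply, Matrix.smul_apply, smul_eq_mul, one_apply] at h1 h2
    rw [h1, h2]; simp
  have hsum : ∑ a, P (single a a (1 : ℝ)) o o = 2 ^ Fintype.card ι := by
    simp only [hP, cliffordAverage_apply]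
    have h0 := sum_sum_list_sum (κ' := Unit) (Finset.univ : Finset ι).toList.sublists'
      fun s (a : κ) _ => (monomialProd J s * single a a (1 : ℝ) * (monomialProd J s)ᵀ : Matrix κ κ ℝ) o o
    simp only [Finset.univ_unique, Finset.sum_singleton] at h0
    rw [h0]
    have : ((Finset.univ : Finset ι).toList.sublists'.map fun s =>
        ∑ a, (monomialProd J s * single a a (1 : ℝ) * (monomialProd J s)ᵀ : Matrix κ κ ℝ) o o) =
        (Finset.univ : Finset ι).toList.sublists'.map fun _ => (1 : ℝ) := by
      refine List.map_congr_left fun s hs => ?_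
      rw [List.mem_sublists'] at hs
      have hnd := hs.nodup (Finset.nodup_toList _)
      have hone : ∑ a : κ, single a a (1 : ℝ) = 1 := by
        ext a b; simp [Matrix.sum_apply, Matrix.single_apply, Matrix.one_apply, ite_and]
      rw [← Matrix.sum_apply, ← Finset.sum_mul, ← Finset.mul_sum, hone, Matrix.mul_one,
        h.transpose_monomialProd s hnd, Matrix.mul_smul, h.monomialProd_mul_self s hnd, smul_smul]
      have : ∀ k, reversalSign k * reversalSign k = 1 := by
        intro k
        induction k with
        | zero => simp [reversalSign]
        | succ k ih =>
          have h2 : ((-1 : ℝ) ^ k) * (-1) ^ k = 1 := by rw [← mul_pow]; simp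
          simp only [reversalSign]
          linear_combination ih + (reversalSign k) * (reversalSign k) * h2
      simp [this]
    rw [this]
    simp
  calc _ = ∑ a : κ, ∑ b, if a = b then P (single a b 1) o o + P (single a b 1) o o else 0 := by
        refine Finset.sum_congr rfl fun a _ => Finset.sum_congr rfl fun b _ => ?_
        exact hoff _ a b
    _ = 2 ^ (Fintype.card ι + 1) := by
        simp only [Finset.sum_ite_eq, Finset.mem_univ, if_true, Finset.sum_add_distrib, hsum]
        ring

/-- Irreducible systems of the same rank `n ≢ 3 (mod 4)` are orthogonally equivalent. -/
lemma exists_orthogonal_intertwiner [Nonempty κ] [Nonempty κ'] (h : IsCliffordSystem J)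
    (h' : IsCliffordSystem J') (hι : Fintype.card ι % 4 ≠ 3) (hirr : IsSymmIrreducible J)
    (hirr' : IsSymmIrreducible J') :
    ∃ O : Matrix κ κ' ℝ, (∀ i, J i * O = O * J' i) ∧ Oᵀ * O = 1 ∧ O * Oᵀ = 1 := by
  obtain ⟨X, hX, hX0⟩ : ∃ X : Matrix κ κ' ℝ, (∀ i, J i * X = X * J' i) ∧ X ≠ 0 := by
    by_contra! hcon
    have h0 := sum_average_single J' h hι
    have hz (a : κ) (b : κ') :=
      hcon _ (h.average_intertwines h' (single a b (1 : ℝ)))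
    simp only [hz] at h0
    simp at h0
  have hXt (i : ι) : J' i * Xᵀ = Xᵀ * J i := by
    have h2 := congrArg Matrix.transpose (hX i)
    simp only [transpose_mul, h.skew, h'.skew, Matrix.mul_neg, Matrix.neg_mul, neg_inj] at h2
    exact h2.symm
  obtain ⟨c, hc⟩ := hirr' (Xᵀ * X) (by simp) fun i => by
    rw [← Matrix.mul_assoc, hXt, Matrix.mul_assoc, hX, Matrix.mul_assoc]
  obtain ⟨d, hd⟩ := hirr (X * Xᵀ) (by simp) fun i => by
    rw [← Matrix.mul_assoc, hX, Matrix.mul_assoc, hXt, Matrix.mul_assoc]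
  have hcd : c = d := by
    have h1 : c • X = d • X := by
      calc c • X = X * (Xᵀ * X) := by rw [hc]; simp
        _ = d • X := by rw [← Matrix.mul_assoc, hd]; simp
    by_contra hne
    rw [← sub_eq_zero, ← sub_smul, smul_eq_zero, sub_eq_zero] at h1
    tauto
  have hcpos : 0 < c := by
    obtain ⟨b⟩ := ‹Nonempty κ'›
    have hb : c = ∑ a, X a b * X a b := by
      have := congrFun (congrFun hc b) b
      simpa [Matrix.mul_apply] using this.symm
    have hnn : 0 ≤ c := by rw [hb]; exact Finset.sum_nonneg fun a _ => mul_self_nonneg _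
    refine lt_of_le_of_ne hnn fun h0 => hX0 ?_
    have : Xᵀ * X = 0 := by rw [hc, ← h0, zero_smul]
    rwa [← conjTranspose_eq_transpose_of_trivial,
      Matrix.conjTranspose_mul_self_eq_zero] at this
  have hs : (√c)⁻¹ * ((√c)⁻¹ * c) = 1 := by
    have := Real.mul_self_sqrt hcpos.le
    have h0 := (Real.sqrt_pos.2 hcpos).ne'
    field_simp
    nlinarith
  refine ⟨(√c)⁻¹ • X, fun i => by simp [hX], ?_, ?_⟩
  · simp [hc, smul_smul, hs]
  · simp [hd, ← hcd, smul_smul, hs]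

end IsCliffordSystem

/-- A symmetric matrix has an orthonormal basis of some eigenspace; the span of such a basis is
stable under every commuting matrix. -/
lemma exists_eigenspace_isometry {N : Type} [Fintype N] [DecidableEq N] [Nonempty N]
    (T : Matrix N N ℝ) (hT : Tᵀ = T) :
    ∃ (κ : Type) (_ : Fintype κ) (_ : DecidableEq κ) (_ : Nonempty κ) (U : Matrix N κ ℝ) (μ : ℝ),
      Uᵀ * U = 1 ∧ T * U = μ • U ∧
      ∀ X : Matrix N N ℝ, T * X = X * T → U * (Uᵀ * (X * U)) = X * U := by
  have hH : T.IsHermitian := by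
    rw [Matrix.IsHermitian, conjTranspose_eq_transpose_of_trivial, hT]
  obtain ⟨o⟩ := ‹Nonempty N›
  set W : Matrix N N ℝ := hH.eigenvectorUnitary.1 with hW
  set d := hH.eigenvalues with hd
  have hWW : Wᵀ * W = 1 := by
    have := Matrix.mem_unitaryGroup_iff'.1 hH.eigenvectorUnitary.2
    rwa [star_eq_conjTranspose, conjTranspose_eq_transpose_of_trivial] at this
  have hWW' : W * Wᵀ = 1 := mul_eq_one_comm.1 hWW
  have hTW : T * W = W * diagonal d := by
    ext a b
    have := congrFun (hH.mulVec_eigenvectorBasis b) a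
    simp only [Matrix.mul_diagonal]
    rw [Matrix.mul_apply]
    simpa [Matrix.mulVec, dotProduct, hW, mul_comm] using this
  let κ := {a : N // d a = d o}
  let U : Matrix N κ ℝ := W.submatrix id Subtype.val
  have hTU : T * U = d o • U := by
    ext a b
    have := congrFun (congrFun hTW a) b.1
    rw [Matrix.mul_diagonal, b.2] at this
    simpa [U, Matrix.mul_apply, mul_comm] using this
  refine ⟨κ, inferInstance, inferInstance, ⟨⟨o, rfl⟩⟩, U, d o, ?_, hTU, fun X hX => ?_⟩
  · ext a b
    have := congrFun (congrFun hWW a.1) b.1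
    have hab : a.1 = b.1 ↔ a = b := Subtype.ext_iff.symm
    simpa [U, Matrix.mul_apply, Matrix.one_apply, hab] using this
  · set Y := X * U with hY
    have hTY : T * Y = d o • Y := by
      rw [hY, ← Matrix.mul_assoc, hX, Matrix.mul_assoc, hTU, Matrix.mul_smul]
    have hWT : Wᵀ * T = diagonal d * Wᵀ := by
      have := congrArg Matrix.transpose hTW
      simpa [hT] using this
    have hzero (a : N) (b : κ) (ha : d a ≠ d o) : (Wᵀ * Y) a b = 0 := by
      have h1 : diagonal d * (Wᵀ * Y) = d o • (Wᵀ * Y) := by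
        rw [← Matrix.mul_assoc, ← hWT, Matrix.mul_assoc, hTY, Matrix.mul_smul]
      have h2 := congrFun (congrFun h1 a) b
      rw [Matrix.diagonal_mul, Matrix.smul_apply, smul_eq_mul, ← sub_eq_zero, ← sub_mul,
        mul_eq_zero, sub_eq_zero] at h2
      tauto
    calc U * (Uᵀ * Y) = W * (Wᵀ * Y) := by
          ext a b
          rw [Matrix.mul_apply, Matrix.mul_apply]
          have hU (c : κ) : U a c * (Uᵀ * Y) c b = W a c.1 * (Wᵀ * Y) c.1 b := by
            simp [U, Matrix.mul_apply]
          simp only [hU]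
          rw [← Fintype.sum_subtype_add_sum_subtype (fun c => d c = d o)
              (fun c => W a c * (Wᵀ * Y) c b), left_eq_add]
          exact Finset.sum_eq_zero fun c _ => by rw [hzero c.1 b c.2, mul_zero]
      _ = Y := by rw [← Matrix.mul_assoc, hWW', Matrix.one_mul]

lemma card_le_of_transpose_mul_eq_one {N κ : Type} [Fintype N] [Fintype κ] [DecidableEq κ]
    (U : Matrix N κ ℝ) (hU : Uᵀ * U = 1) : Fintype.card κ ≤ Fintype.card N := by
  classical
  calc Fintype.card κ = (1 : Matrix κ κ ℝ).rank := by rw [Matrix.rank_one]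
    _ = (Uᵀ * U).rank := by rw [hU]
    _ ≤ U.rank := Matrix.rank_mul_le_right _ _
    _ ≤ Fintype.card N := Matrix.rank_le_card_height _

lemma eq_smul_one_of_card_eq {N κ : Type} [Fintype N] [DecidableEq N] [Fintype κ] [DecidableEq κ]
    {T : Matrix N N ℝ} {U : Matrix N κ ℝ} {μ : ℝ} (hU : Uᵀ * U = 1) (hTU : T * U = μ • U)
    (hcard : Fintype.card N ≤ Fintype.card κ) : T = μ • (1 : Matrix N N ℝ) := by
  have he : Fintype.card κ = Fintype.card N :=
    le_antisymm (card_le_of_transpose_mul_eq_one U hU) hcard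
  have hUU : U * Uᵀ = 1 := (Matrix.mul_eq_one_comm_of_card_eq κ N ℝ he).1 hU
  calc T = T * (U * Uᵀ) := by rw [hUU, Matrix.mul_one]
    _ = μ • (1 : Matrix N N ℝ) := by rw [← Matrix.mul_assoc, hTU, Matrix.smul_mul, hUU]

/-- Compressing a Clifford family to a stable subspace. -/
lemma IsCliffordFamily.compress {ι N κ : Type} [Fintype N] [DecidableEq N] [Fintype κ]
    [DecidableEq κ] {ε : ℝ} {J : ι → Matrix N N ℝ} (h : IsCliffordFamily ε J) {U : Matrix N κ ℝ}
    (hU : Uᵀ * U = 1) (hst : ∀ i, U * (Uᵀ * (J i * U)) = J i * U) :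
    IsCliffordFamily ε (fun i => Uᵀ * (J i * U)) := by
  have key (i j : ι) : Uᵀ * (J i * U) * (Uᵀ * (J j * U)) = Uᵀ * ((J i * J j) * U) := by
    rw [Matrix.mul_assoc, Matrix.mul_assoc, hst, Matrix.mul_assoc (J i)]
  refine ⟨fun i => ?_, fun i j hij => ?_⟩
  · rw [key, h.sq]; simp [hU]
  · rw [key, key, h.anti i j hij]; simp

lemma IsCliffordSystem.compress {ι N κ : Type} [Fintype N] [DecidableEq N] [Fintype κ]
    [DecidableEq κ] {J : ι → Matrix N N ℝ} (h : IsCliffordSystem J) {U : Matrix N κ ℝ}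
    (hU : Uᵀ * U = 1) (hst : ∀ i, U * (Uᵀ * (J i * U)) = J i * U) :
    IsCliffordSystem (fun i => Uᵀ * (J i * U)) where
  toIsCliffordFamily := h.toIsCliffordFamily.compress hU hst
  skew i := by simp [h.skew, Matrix.mul_assoc]

/-- `d` is the least size of a Clifford system indexed by `ι`. -/
def IsLeastCliffordDim (ι : Type) (d : ℕ) : Prop :=
  IsLeast {d : ℕ | ∃ (κ : Type) (_ : Fintype κ) (_ : DecidableEq κ) (_ : Nonempty κ)
    (J : ι → Matrix κ κ ℝ), IsCliffordSystem J ∧ Fintype.card κ = d} d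

namespace IsCliffordSystem

variable {ι κ : Type} [Fintype κ] [DecidableEq κ] [Nonempty κ] {J : ι → Matrix κ κ ℝ}

lemma exists_isLeast (h : IsCliffordSystem J) : ∃ d, IsLeastCliffordDim ι d := by
  classical
  refine ⟨_, Nat.isLeast_find (p := fun d => ∃ (κ : Type) (_ : Fintype κ) (_ : DecidableEq κ)
    (_ : Nonempty κ) (J : ι → Matrix κ κ ℝ), IsCliffordSystem J ∧ Fintype.card κ = d) ?_⟩
  exact ⟨_, κ, _, _, ‹_›, J, h, rfl⟩

lemma le_card (h : IsCliffordSystem J) {d : ℕ} (hd : IsLeastCliffordDim ι d) :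
    d ≤ Fintype.card κ :=
  hd.2 ⟨κ, _, _, ‹_›, J, h, rfl⟩

lemma isSymmIrreducible (h : IsCliffordSystem J) (hd : IsLeastCliffordDim ι (Fintype.card κ)) :
    IsSymmIrreducible J := by
  intro T hT hcomm
  obtain ⟨κ', _, _, _, U, μ, hU, hTU, hst⟩ := exists_eigenspace_isometry T hT
  exact ⟨μ, eq_smul_one_of_card_eq hU hTU
    ((h.compress hU fun i => hst _ (hcomm i).symm).le_card hd)⟩

end IsCliffordSystem

lemma IsLeastCliffordDim.equation {ι : Type} [Fintype ι] {d : ℕ} (hd : IsLeastCliffordDim ι d)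
    (hι : Fintype.card ι % 4 ≠ 3) :
    (d : ℝ) * d + d * reversalSum (Fintype.card ι) 0 = 2 ^ (Fintype.card ι + 1) ∧ 0 < d := by
  obtain ⟨κ, _, _, _, J, hJ, rfl⟩ := hd.1
  exact ⟨hJ.card_equation hι (hJ.isSymmIrreducible hd), Fintype.card_pos⟩

lemma isLeastCliffordDim_eq {n q d j c : ℕ} (hn : n = 8 * q + j)
    (hj : j = 0 ∧ c = 1 ∨ j = 1 ∧ c = 2 ∨ j = 2 ∧ c = 4 ∨ j = 4 ∧ c = 8 ∨ j = 5 ∧ c = 8 ∨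
      j = 6 ∧ c = 8) (hd : IsLeastCliffordDim (Fin n) d) : d = c * 16 ^ q := by
  obtain ⟨heq, hpos⟩ := hd.equation (by rw [Fintype.card_fin]; omega)
  rw [Fintype.card_fin, hn, reversalSum_add_eight_mul] at heq
  have hpow : (2 : ℝ) ^ (8 * q + j + 1) = (16 ^ q) * 16 ^ q * 2 ^ (j + 1) := by
    rw [← mul_pow, add_assoc, pow_add, pow_mul]; norm_num
  rw [hpow] at heq
  have ha : (0 : ℝ) < 16 ^ q := by positivity
  have hd0 : (0 : ℝ) < d := by exact_mod_cast hpos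
  set a : ℝ := 16 ^ q with haq
  suffices H : (d : ℝ) = c * a by
    rw [haq] at H; exact_mod_cast H
  rcases hj with ⟨rfl, rfl⟩ | ⟨rfl, rfl⟩ | ⟨rfl, rfl⟩ | ⟨rfl, rfl⟩ | ⟨rfl, rfl⟩ | ⟨rfl, rfl⟩ <;>
    norm_num [reversalSum, reversalSign] at heq ⊢
  · have : ((d : ℝ) - a) * (d + 2 * a) = 0 := by linear_combination heq
    rcases mul_eq_zero.1 this with h | h <;> nlinarith
  · have : ((d : ℝ) - 2 * a) * (d + 2 * a) = 0 := by linear_combination heq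
    rcases mul_eq_zero.1 this with h | h <;> nlinarith
  · have : ((d : ℝ) - 4 * a) * (d + 2 * a) = 0 := by linear_combination heq
    rcases mul_eq_zero.1 this with h | h <;> nlinarith
  · have : ((d : ℝ) - 8 * a) * (d + 4 * a) = 0 := by linear_combination heq
    rcases mul_eq_zero.1 this with h | h <;> nlinarith
  · have : ((d : ℝ) - 8 * a) * (d + 8 * a) = 0 := by linear_combination heq
    rcases mul_eq_zero.1 this with h | h <;> nlinarith
  · have : ((d : ℝ) - 8 * a) * (d + 16 * a) = 0 := by linear_combination heq
    rcases mul_eq_zero.1 this with h | h <;> nlinarith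

namespace IsCliffordSystem

variable {n : ℕ} {κ : Type} [Fintype κ] [DecidableEq κ]

lemma snoc {J : Fin n → Matrix κ κ ℝ} (h : IsCliffordSystem J) {K : Matrix κ κ ℝ}
    (hsq : K * K = -1) (hskew : Kᵀ = -K) (hanti : ∀ i, J i * K = -(K * J i)) :
    IsCliffordSystem (Fin.snoc J K : Fin (n + 1) → Matrix κ κ ℝ) where
  sq i := by
    refine Fin.lastCases ?_ (fun i => ?_) i
    · simp [hsq]
    · simp [h.mul_self]
  anti i j := by
    refine Fin.lastCases ?_ (fun i => ?_) i <;> refine Fin.lastCases ?_ (fun j => ?_) j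
    · simp
    · intro _; simp [hanti]
    · intro _; simp [hanti]
    · intro hij
      simpa using h.anti i j (by simpa using hij)
  skew i := by
    refine Fin.lastCases ?_ (fun i => ?_) i
    · simpa using hskew
    · simpa using h.skew i

lemma castSucc {J : Fin (n + 1) → Matrix κ κ ℝ} (h : IsCliffordSystem J) :
    IsCliffordSystem (fun i : Fin n => J i.castSucc) where
  toIsCliffordFamily := h.toIsCliffordFamily.comp (Fin.castSucc_injective n)
  skew _ := h.skew _

/-- The volume element of a system of rank `n ≡ 2 (mod 4)` extends it to rank `n + 1`. -/
lemma exists_succ_of_mod_four {J : Fin n → Matrix κ κ ℝ} (h : IsCliffordSystem J)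
    (hn : n % 4 = 2) : ∃ J' : Fin (n + 1) → Matrix κ κ ℝ, IsCliffordSystem J' := by
  have hs : reversalSign n = -1 := by
    rw [reversalSign_mod, hn]; norm_num [reversalSign]
  refine ⟨_, h.snoc (K := monomialProd J (List.finRange n)) ?_ ?_ fun i => ?_⟩
  · rw [h.monomialProd_mul_self _ (List.nodup_finRange n), List.length_finRange, hs]; simp
  · rw [h.transpose_monomialProd _ (List.nodup_finRange n), List.length_finRange, hs]; simp
  · exact h.anticomm_monomialProd _ (List.nodup_finRange n)
      (by rw [List.length_finRange, Nat.even_iff]; omega) (List.mem_finRange i)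

end IsCliffordSystem

/-- A symmetric involution anticommuting with a Clifford system. -/
structure IsCliffordGrading {ι κ : Type} [Fintype κ] [DecidableEq κ]
    (J : ι → Matrix κ κ ℝ) (τ : Matrix κ κ ℝ) : Prop where
  symm : τᵀ = τ
  sq : τ * τ = 1
  anti : ∀ i, J i * τ = -(τ * J i)

namespace IsCliffordSystem

variable {n : ℕ} {κ : Type} [Fintype κ] [DecidableEq κ]

lemma exists_grading_of_mod_four {J : Fin n → Matrix κ κ ℝ} (h : IsCliffordSystem J)
    (hn : n % 4 = 0) : ∃ τ, IsCliffordGrading J τ := by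
  have hs : reversalSign n = 1 := by
    rw [reversalSign_mod, hn]; norm_num [reversalSign]
  refine ⟨monomialProd J (List.finRange n), ?_, ?_, fun i => ?_⟩
  · rw [h.transpose_monomialProd _ (List.nodup_finRange n), List.length_finRange, hs]; simp
  · rw [h.monomialProd_mul_self _ (List.nodup_finRange n), List.length_finRange, hs]; simp
  · exact h.anticomm_monomialProd _ (List.nodup_finRange n)
      (by rw [List.length_finRange, Nat.even_iff]; omega) (List.mem_finRange i)

/-- Doubling a system raises its rank by one and provides a grading. -/
lemma exists_double {J : Fin n → Matrix κ κ ℝ} (h : IsCliffordSystem J) :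
    ∃ (J' : Fin (n + 1) → Matrix (κ ⊕ κ) (κ ⊕ κ) ℝ) (τ : Matrix (κ ⊕ κ) (κ ⊕ κ) ℝ),
      IsCliffordSystem J' ∧ IsCliffordGrading J' τ := by
  have h0 : IsCliffordSystem (fun i => fromBlocks 0 (J i) (J i) 0) :=
    { sq := fun i => by
        simp [fromBlocks_multiply, h.mul_self, ← fromBlocks_one, fromBlocks_neg]
      anti := fun i j hij => by
        simp [fromBlocks_multiply, fromBlocks_neg, h.anti i j hij]
      skew := fun i => by simp [fromBlocks_transpose, fromBlocks_neg, h.skew] }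
  refine ⟨_, fromBlocks 1 0 0 (-1), h0.snoc (K := fromBlocks 0 (-1) 1 0) ?_ ?_ fun i => ?_,
    ?_, ?_, fun i => ?_⟩
  · simp [fromBlocks_multiply, ← fromBlocks_one, fromBlocks_neg]
  · simp [fromBlocks_transpose, fromBlocks_neg]
  · simp [fromBlocks_multiply, fromBlocks_neg]
  · simp [fromBlocks_transpose]
  · simp [fromBlocks_multiply]
  · refine Fin.lastCases ?_ (fun i => ?_) i
    · simp [fromBlocks_multiply, fromBlocks_neg]
    · simp [fromBlocks_multiply, fromBlocks_neg]

/-- A graded system of rank `n + 1` contains a system of rank `n` of at most half the size. -/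
lemma exists_half [Nonempty κ] {J : Fin (n + 1) → Matrix κ κ ℝ} (h : IsCliffordSystem J)
    {τ : Matrix κ κ ℝ} (hτ : IsCliffordGrading J τ) :
    ∃ (κ' : Type) (_ : Fintype κ') (_ : DecidableEq κ') (_ : Nonempty κ')
      (J' : Fin n → Matrix κ' κ' ℝ), IsCliffordSystem J' ∧
        2 * Fintype.card κ' ≤ Fintype.card κ := by
  set K := J (Fin.last n) with hK
  have hσ : (K * τ)ᵀ = K * τ := by
    rw [transpose_mul, hτ.symm, h.skew, hτ.anti, Matrix.mul_neg]
  have hσsq : (K * τ) * (K * τ) = 1 := by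
    nth_rewrite 1 [hτ.anti]
    rw [Matrix.neg_mul, Matrix.mul_assoc, ← Matrix.mul_assoc K, h.mul_self]
    simp [hτ.sq]
  have hστ : (K * τ) * τ = -(τ * (K * τ)) := by
    nth_rewrite 1 [hτ.anti]
    rw [Matrix.neg_mul, Matrix.mul_assoc]
  have hcomm (i : Fin n) : (K * τ) * J i.castSucc = J i.castSucc * (K * τ) := by
    have h2 : τ * J i.castSucc = -(J i.castSucc * τ) := by rw [hτ.anti, neg_neg]
    rw [Matrix.mul_assoc, h2, ← Matrix.mul_assoc, h.anti _ _ (Fin.castSucc_lt_last i).ne,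
      Matrix.neg_mul, Matrix.mul_assoc, Matrix.mul_neg]
  obtain ⟨κ', _, _, _, U, μ, hU, hTU, hst⟩ := exists_eigenspace_isometry (K * τ) hσ
  refine ⟨κ', _, _, ‹_›, _, h.castSucc.compress hU fun i => hst _ (hcomm i), ?_⟩
  have hμ : μ * μ = 1 := by
    have h1 : Uᵀ * (K * τ * (K * τ * U)) = (μ * μ) • (1 : Matrix κ' κ' ℝ) := by
      rw [hTU, Matrix.mul_smul, hTU, smul_smul, Matrix.mul_smul, hU]
    rw [← Matrix.mul_assoc (K * τ), hσsq, Matrix.one_mul, hU] at h1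
    obtain ⟨o⟩ := ‹Nonempty κ'›
    simpa using (congrFun (congrFun h1 o) o).symm
  have hUT : Uᵀ * (K * τ) = μ • Uᵀ := by
    have := congrArg Matrix.transpose hTU
    rwa [transpose_mul, hσ, transpose_smul] at this
  have horth : Uᵀ * (τ * U) = 0 := by
    have h1 : μ • (Uᵀ * (τ * U)) = -(μ • (Uᵀ * (τ * U))) := by
      calc μ • (Uᵀ * (τ * U)) = Uᵀ * (K * τ * τ * U) := by
            rw [← Matrix.smul_mul, ← hUT]; simp only [Matrix.mul_assoc]
        _ = -(μ • (Uᵀ * (τ * U))) := by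
            rw [hστ, Matrix.neg_mul, Matrix.mul_assoc τ, hTU]; simp
    have h2 : μ • (Uᵀ * (τ * U)) = 0 := by
      ext a b
      have := congrFun (congrFun h1 a) b
      simp only [Matrix.neg_apply] at this
      simp only [Matrix.zero_apply]
      linarith
    calc Uᵀ * (τ * U) = (μ * μ) • (Uᵀ * (τ * U)) := by rw [hμ, one_smul]
      _ = 0 := by rw [mul_smul, h2, smul_zero]
  have := card_le_of_transpose_mul_eq_one (fromCols U (τ * U)) (by
    rw [transpose_fromCols, fromRows_mul_fromCols, hU, horth, transpose_mul, hτ.symm,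
      Matrix.mul_assoc, horth, Matrix.mul_assoc, ← Matrix.mul_assoc τ, hτ.sq, Matrix.one_mul, hU,
      fromBlocks_one])
  rw [Fintype.card_sum] at this
  omega

end IsCliffordSystem

lemma matrix_eq_of_dotProduct_mulVec {κ κ' : Type} [Fintype κ] [Fintype κ'] [DecidableEq κ]
    [DecidableEq κ'] {A B : Matrix κ κ' ℝ} (h : ∀ x y, x ⬝ᵥ A *ᵥ y = x ⬝ᵥ B *ᵥ y) : A = B := by
  ext a b
  simpa using h (Pi.single a 1) (Pi.single b 1)

lemma IsCliffordFamily.posDef_average {ι κ : Type} [Fintype κ] [DecidableEq κ]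
    (J : ι → Matrix κ κ ℝ) (l : List ι) :
    (cliffordAverage (fun i => (J i)ᵀ) (fun i => (J i)ᵀ) 1 l).PosDef := by
  induction l with
  | nil => exact Matrix.PosDef.one
  | cons i l ih =>
    refine ih.add_posSemidef ?_
    have := ih.posSemidef.conjTranspose_mul_mul_same (J i)
    rwa [conjTranspose_eq_transpose_of_trivial] at this

/-- Every Clifford family is similar to an orthogonal one. -/
lemma IsCliffordFamily.exists_orthogonal {ι κ : Type} [Fintype ι] [Fintype κ] [DecidableEq κ]
    {ε : ℝ} (hε : ε * ε = 1) {J : ι → Matrix κ κ ℝ} (h : IsCliffordFamily ε J) :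
    ∃ C D : Matrix κ κ ℝ, C * D = 1 ∧ D * C = 1 ∧
      ∀ i, (C * J i * D)ᵀ = ε • (C * J i * D) := by
  have hG := IsCliffordFamily.posDef_average J Finset.univ.toList
  have hinv (i : ι) := cliffordAverage_invariant hε h.transpose h.transpose 1
    Finset.univ.toList (j := i) (by simp)
  set G := cliffordAverage (fun i => (J i)ᵀ) (fun i => (J i)ᵀ) 1 Finset.univ.toList
  obtain ⟨C, hC⟩ : ∃ C : Matrix κ κ ℝ, G = Cᵀ * C := by
    open scoped MatrixOrder in
    obtain ⟨C, hC⟩ := CStarAlgebra.nonneg_iff_eq_star_mul_self.1 hG.posSemidef.nonneg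
    exact ⟨C, by rwa [star_eq_conjTranspose, conjTranspose_eq_transpose_of_trivial] at hC⟩
  obtain ⟨D, hD⟩ : ∃ D, D * C = 1 := by
    obtain ⟨u, hu⟩ := hG.isUnit
    refine ⟨(↑u⁻¹ : Matrix κ κ ℝ) * Cᵀ, ?_⟩
    rw [Matrix.mul_assoc, ← hC, ← hu, Units.inv_mul]
  have hD' : C * D = 1 := mul_eq_one_comm.1 hD
  refine ⟨C, D, hD', hD, fun i => ?_⟩
  have hDt : Dᵀ * Cᵀ = 1 := by rw [← transpose_mul, hD', transpose_one]
  have horth : (C * J i * D)ᵀ * (C * J i * D) = 1 := by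
    have h1 := hinv i
    rw [transpose_transpose, hC] at h1
    calc (C * J i * D)ᵀ * (C * J i * D) = Dᵀ * ((J i)ᵀ * (Cᵀ * C) * J i) * D := by
          simp only [transpose_mul, Matrix.mul_assoc]
      _ = (Dᵀ * Cᵀ) * (C * D) := by rw [h1]; simp only [Matrix.mul_assoc]
      _ = 1 := by rw [hDt, hD', Matrix.one_mul]
  have hsq : (C * J i * D) * (C * J i * D) = ε • (1 : Matrix κ κ ℝ) := by
    calc (C * J i * D) * (C * J i * D) = C * (J i * ((D * C) * J i)) * D := by
          simp only [Matrix.mul_assoc]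
      _ = ε • (1 : Matrix κ κ ℝ) := by rw [hD, Matrix.one_mul, h.sq]; simp [hD']
  set K := C * J i * D
  calc Kᵀ = ε • (Kᵀ * (K * K)) := by rw [hsq]; simp [smul_smul, hε]
    _ = ε • K := by rw [← Matrix.mul_assoc, horth, Matrix.one_mul]

/-- Orthogonal coordinates for a space with anticommuting operators of square `ε` that are
skew-adjoint for a nondegenerate symmetric form. -/
lemma exists_orthogonal_coordinates {ι V : Type} [Fintype ι] [AddCommGroup V] [Module ℝ V]
    [FiniteDimensional ℝ V] {ε : ℝ} (hε : ε * ε = 1) (B : V →ₗ[ℝ] V →ₗ[ℝ] ℝ)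
    (J : ι → V →ₗ[ℝ] V) (hsq : ∀ i v, J i (J i v) = ε • v)
    (hanti : ∀ i j, i ≠ j → ∀ v, J i (J j v) = -J j (J i v))
    (hsymm : ∀ v w, B v w = B w v) (hnd : ∀ v, (∀ w, B v w = 0) → v = 0)
    (hskew : ∀ i v w, B (J i v) w = -B v (J i w)) :
    ∃ (e : V ≃ₗ[ℝ] (Fin (Module.finrank ℝ V) → ℝ))
      (K : ι → Matrix (Fin (Module.finrank ℝ V)) (Fin (Module.finrank ℝ V)) ℝ)
      (S : Matrix (Fin (Module.finrank ℝ V)) (Fin (Module.finrank ℝ V)) ℝ),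
      IsCliffordFamily ε K ∧ (∀ i, (K i)ᵀ = ε • K i) ∧ (∀ i v, e (J i v) = K i *ᵥ e v) ∧
      (∀ v w, B v w = e v ⬝ᵥ S *ᵥ e w) ∧ Sᵀ = S ∧ IsUnit S ∧
      ∀ i, (K i)ᵀ * S = -(S * K i) := by
  set b := Module.finBasis ℝ V
  set M : ι → Matrix _ _ ℝ := fun i => LinearMap.toMatrix b b (J i) with hM
  have hMJ (i : ι) (v : V) : b.equivFun (J i v) = M i *ᵥ b.equivFun v :=
    (LinearMap.toMatrix_mulVec_repr b b (J i) v).symm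
  have hMC : IsCliffordFamily ε M := by
    refine ⟨fun i => ?_, fun i j hij => ?_⟩
    · rw [hM, ← LinearMap.toMatrix_comp, ← LinearMap.toMatrix_id b, ← map_smul]
      congr 1
      ext v
      simp [hsq]
    · rw [hM, ← LinearMap.toMatrix_comp, ← LinearMap.toMatrix_comp, ← map_neg]
      congr 1
      ext v
      simp [hanti i j hij]
  obtain ⟨C, D, hCD, hDC, hK⟩ := hMC.exists_orthogonal hε
  set e : V ≃ₗ[ℝ] (Fin (Module.finrank ℝ V) → ℝ) :=
    b.equivFun.trans (Matrix.toLin'OfInv hDC hCD) with he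
  have he' (v : V) : e v = C *ᵥ b.equivFun v := rfl
  set S := LinearMap.toMatrix₂' ℝ (B.compl₁₂ e.symm.toLinearMap e.symm.toLinearMap) with hS
  have hBS (v w : V) : B v w = e v ⬝ᵥ S *ᵥ e w := by
    rw [← Matrix.toLinearMap₂'_apply', hS, Matrix.toLinearMap₂'_toMatrix']
    simp
  have hKe (i : ι) (v : V) : e (J i v) = (C * M i * D) *ᵥ e v := by
    rw [he', he', hMJ, Matrix.mulVec_mulVec, Matrix.mulVec_mulVec, Matrix.mul_assoc _ D, hDC,
      Matrix.mul_one]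
  refine ⟨e, fun i => C * M i * D, S, ?_, hK, hKe, hBS, ?_, ?_, fun i => ?_⟩
  · have hmul (i j : ι) : C * M i * D * (C * M j * D) = C * (M i * M j) * D := by
      calc _ = C * (M i * ((D * C) * M j)) * D := by simp only [Matrix.mul_assoc]
        _ = _ := by rw [hDC, Matrix.one_mul]
    refine ⟨fun i => ?_, fun i j hij => ?_⟩
    · rw [hmul, hMC.sq]; simp [hCD]
    · rw [hmul, hmul, hMC.anti i j hij]; simp
  · refine matrix_eq_of_dotProduct_mulVec fun x y => ?_
    have h1 := hBS (e.symm x) (e.symm y)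
    have h2 := hBS (e.symm y) (e.symm x)
    simp only [LinearEquiv.apply_symm_apply] at h1 h2
    rw [← h1, hsymm, h2, Matrix.dotProduct_mulVec, Matrix.vecMul_transpose, dotProduct_comm]
  · rw [← Matrix.mulVec_injective_iff_isUnit]
    refine (injective_iff_map_eq_zero S.mulVecLin).2 fun x hx => ?_
    rw [Matrix.mulVecLin_apply] at hx
    rw [← LinearEquiv.map_eq_zero_iff e.symm]
    refine hnd _ fun w => ?_
    rw [hsymm, hBS, LinearEquiv.apply_symm_apply, hx, dotProduct_zero]
  · refine matrix_eq_of_dotProduct_mulVec fun x y => ?_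
    have h1 := hskew i (e.symm x) (e.symm y)
    rw [hBS, hBS, hKe, hKe] at h1
    simp only [LinearEquiv.apply_symm_apply] at h1
    rw [Matrix.neg_mulVec, dotProduct_neg, ← Matrix.mulVec_mulVec, ← Matrix.mulVec_mulVec, ← h1,
      Matrix.dotProduct_mulVec, Matrix.vecMul_transpose]

lemma IsCliffordFamily.sum_mul_sum {ι κ : Type} [Fintype ι] [Fintype κ] [DecidableEq κ]
    {ε : ℝ} {K : ι → Matrix κ κ ℝ} (h : IsCliffordFamily ε K) (Z : ι → ℝ) :
    (∑ i, Z i • K i) * (∑ i, Z i • K i) = (ε * (Z ⬝ᵥ Z)) • (1 : Matrix κ κ ℝ) := by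
  classical
  have hij (i j : ι) : K i * K j + K j * K i = if i = j then (2 * ε) • 1 else 0 := by
    split_ifs with hij
    · subst hij; rw [h.sq, two_mul, add_smul]
    · rw [h.anti i j hij, neg_add_cancel]
  have h1 : (∑ i, Z i • K i) * (∑ i, Z i • K i) = ∑ i, ∑ j, (Z i * Z j) • (K i * K j) := by
    simp [Finset.sum_mul_sum, smul_smul, mul_comm]
  have h2 : (∑ i, Z i • K i) * (∑ i, Z i • K i) = ∑ i, ∑ j, (Z i * Z j) • (K j * K i) := by
    rw [h1, Finset.sum_comm]
    simp [mul_comm]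
  have h3 : (2 : ℝ) • ((∑ i, Z i • K i) * (∑ i, Z i • K i)) =
      (2 : ℝ) • ((ε * (Z ⬝ᵥ Z)) • (1 : Matrix κ κ ℝ)) := by
    rw [two_smul]
    nth_rewrite 1 [h1]
    rw [h2]
    simp only [← Finset.sum_add_distrib, ← smul_add, hij, smul_ite, smul_zero,
      Finset.sum_ite_eq, Finset.mem_univ, if_true, smul_smul, ← Finset.sum_smul]
    congr 1
    simp only [dotProduct, Finset.mul_sum]
    exact Finset.sum_congr rfl fun i _ => by ring
  exact smul_right_injective _ two_ne_zero h3

/-- A Clifford family that is skew-adjoint for an invertible symmetric matrix defines an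
admissible module. -/
lemma IsCliffordFamily.isAdmissible {p q : ℕ} {κ : Type} [Fintype κ] [DecidableEq κ] [Nonempty κ]
    {ε : ℝ} (hform : ∀ Z : Fin (p + q) → ℝ, sform p q Z Z = -(ε * (Z ⬝ᵥ Z)))
    {K : Fin (p + q) → Matrix κ κ ℝ} (h : IsCliffordFamily ε K) {S : Matrix κ κ ℝ}
    (hS : Sᵀ = S) (hunit : IsUnit S) (hskew : ∀ i, (K i)ᵀ * S = -(S * K i)) :
    IsAdmissible p q (κ → ℝ) (Matrix.toLinearMap₂' ℝ S)
      ((Matrix.toLin' : _ ≃ₗ[ℝ] ((κ → ℝ) →ₗ[ℝ] (κ → ℝ))).toLinearMap ∘ₗ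
        Fintype.linearCombination ℝ K) := by
  have hJ (Z : Fin (p + q) → ℝ) (v : κ → ℝ) :
      ((Matrix.toLin' : _ ≃ₗ[ℝ] ((κ → ℝ) →ₗ[ℝ] (κ → ℝ))).toLinearMap ∘ₗ
        Fintype.linearCombination ℝ K) Z v = (∑ i, Z i • K i) *ᵥ v := rfl
  refine ⟨inferInstance, inferInstance, fun v w => ?_, fun v hv => ?_, fun Z v => ?_,
    fun Z v w => ?_⟩
  · rw [Matrix.toLinearMap₂'_apply', Matrix.toLinearMap₂'_apply', dotProduct_comm,
      Matrix.dotProduct_mulVec, ← Matrix.mulVec_transpose, hS]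
  · have hz : S *ᵥ v = 0 := by
      ext a
      have := hv (Pi.single a 1)
      rw [Matrix.toLinearMap₂'_apply', Matrix.dotProduct_mulVec, ← Matrix.mulVec_transpose,
        hS] at this
      simpa using this
    exact Matrix.mulVec_injective_iff_isUnit.2 hunit (by simpa using hz)
  · rw [hJ, hJ, Matrix.mulVec_mulVec, h.sum_mul_sum, hform, neg_neg, Matrix.smul_mulVec,
      Matrix.one_mulVec]
  · have hsum : (∑ i, Z i • K i)ᵀ * S = -(S * ∑ i, Z i • K i) := by
      simp [Matrix.transpose_sum, Finset.sum_mul, Finset.mul_sum, hskew]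
    rw [hJ, hJ, Matrix.toLinearMap₂'_apply', Matrix.toLinearMap₂'_apply', ← dotProduct_neg,
      Matrix.mulVec_mulVec, ← Matrix.neg_mulVec, ← hsum, ← Matrix.mulVec_mulVec,
      Matrix.dotProduct_mulVec v, Matrix.vecMul_transpose]

/-- Coordinates of a minimal admissible module, together with its minimality among all
skew-adjoint Clifford families. -/
lemma IsMinimalAdmissible.exists_coordinates {n p q : ℕ} (f : Fin n ≃ Fin (p + q)) {ε : ℝ}
    (hε : ε * ε = 1) (hform : ∀ Z : Fin (p + q) → ℝ, sform p q Z Z = -(ε * (Z ⬝ᵥ Z)))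
    {V : Type} [AddCommGroup V] [Module ℝ V] {B : V →ₗ[ℝ] V →ₗ[ℝ] ℝ}
    {J : (Fin (p + q) → ℝ) →ₗ[ℝ] V →ₗ[ℝ] V} (h : IsMinimalAdmissible p q V B J) :
    (∃ (e : V ≃ₗ[ℝ] (Fin (Module.finrank ℝ V) → ℝ))
      (K : Fin n → Matrix (Fin (Module.finrank ℝ V)) (Fin (Module.finrank ℝ V)) ℝ)
      (S : Matrix (Fin (Module.finrank ℝ V)) (Fin (Module.finrank ℝ V)) ℝ),
      IsCliffordFamily ε K ∧ (∀ i, (K i)ᵀ = ε • K i) ∧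
      (∀ i v, e (J (Pi.single (f i) 1) v) = K i *ᵥ e v) ∧
      (∀ v w, B v w = e v ⬝ᵥ S *ᵥ e w) ∧ Sᵀ = S ∧ IsUnit S ∧
      ∀ i, (K i)ᵀ * S = -(S * K i)) ∧
    0 < Module.finrank ℝ V ∧
    ∀ (κ : Type) [Fintype κ] [DecidableEq κ] [Nonempty κ] (K : Fin n → Matrix κ κ ℝ)
      (S : Matrix κ κ ℝ), IsCliffordFamily ε K → Sᵀ = S → IsUnit S →
      (∀ i, (K i)ᵀ * S = -(S * K i)) → Module.finrank ℝ V ≤ Fintype.card κ := by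
  obtain ⟨⟨hfin, hnt, hsymm, hnd, hsq, hskew⟩, hmin⟩ := h
  refine ⟨?_, Module.finrank_pos, fun κ _ _ _ K S hK hS hu hKS => ?_⟩
  · have hsq' (Z : Fin (p + q) → ℝ) (v : V) : J Z (J Z v) = (ε * (Z ⬝ᵥ Z)) • v := by
      rw [hsq, hform, neg_neg]
    refine exists_orthogonal_coordinates hε B (fun i => J (Pi.single (f i) 1)) (fun i v => ?_)
      (fun i j hij v => ?_) hsymm hnd (fun i => hskew _)
    · rw [hsq']; simp
    · have hne : f i ≠ f j := f.injective.ne hij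
      have h1 := hsq' (Pi.single (f i) 1 + Pi.single (f j) 1) v
      simp only [map_add, LinearMap.add_apply, hsq'] at h1
      simp only [add_dotProduct, dotProduct_add, single_dotProduct, Pi.single_eq_same,
        Pi.single_eq_of_ne hne, Pi.single_eq_of_ne hne.symm, mul_zero, mul_one, add_zero, zero_add,
        mul_add, add_smul] at h1
      rw [eq_neg_iff_add_eq_zero]
      have h2 : ∀ a b c : V, a + b + (c + a) = a + a → c + b = 0 := by
        intro a b c habc
        have : (c + b) + (a + a) = 0 + (a + a) := by
          calc (c + b) + (a + a) = a + b + (c + a) := by abel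
            _ = 0 + (a + a) := by rw [habc, zero_add]
        exact add_right_cancel this
      exact h2 _ _ _ h1
  · have hfam := hK.comp f.symm.injective
    have := hmin _ _ _ (hfam.isAdmissible hform hS hu fun i => hKS _)
    simpa using this

lemma sform_zero_right_self (r : ℕ) (Z : Fin (r + 0) → ℝ) :
    sform r 0 Z Z = -(-1 * (Z ⬝ᵥ Z)) := by
  have (i : Fin (r + 0)) : (i : ℕ) < r := i.2
  simp [sform, this, dotProduct]

lemma sform_zero_left_self (r : ℕ) (Z : Fin (0 + r) → ℝ) :
    sform 0 r Z Z = -(1 * (Z ⬝ᵥ Z)) := by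
  simp [sform, dotProduct]

lemma sform_zero_right_single (r : ℕ) (i : Fin (r + 0)) (W : Fin (r + 0) → ℝ) :
    sform r 0 (Pi.single i 1) W = W i := by
  have (i : Fin (r + 0)) : (i : ℕ) < r := i.2
  simp [sform, this, Pi.single_apply]

lemma sform_zero_left_single (r : ℕ) (i : Fin (0 + r)) (W : Fin (0 + r) → ℝ) :
    sform 0 r (Pi.single i 1) W = -W i := by
  simp [sform, Pi.single_apply]

/-- A graded Clifford system gives an admissible `Cl_{0,n}`-structure. -/
lemma IsCliffordSystem.isCliffordFamily_grading_mul {ι κ : Type} [Fintype κ] [DecidableEq κ]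
    {J : ι → Matrix κ κ ℝ} (h : IsCliffordSystem J) {τ : Matrix κ κ ℝ}
    (hτ : IsCliffordGrading J τ) :
    IsCliffordFamily 1 (fun i => τ * J i) ∧ IsUnit τ ∧
      ∀ i, (τ * J i)ᵀ * τ = -(τ * (τ * J i)) := by
  have hmul (i j : ι) : τ * J i * (τ * J j) = -(J i * J j) := by
    rw [Matrix.mul_assoc, ← Matrix.mul_assoc (J i), hτ.anti, Matrix.neg_mul, Matrix.mul_neg,
      ← Matrix.mul_assoc, ← Matrix.mul_assoc, hτ.sq, Matrix.one_mul]
  refine ⟨⟨fun i => ?_, fun i j hij => ?_⟩, IsUnit.of_mul_eq_one τ hτ.sq, fun i => ?_⟩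
  · rw [hmul, h.mul_self]; simp
  · rw [hmul, hmul, h.anti i j hij]
  · rw [transpose_mul, hτ.symm, h.skew, Matrix.mul_assoc, hτ.sq, ← Matrix.mul_assoc, hτ.sq,
      Matrix.mul_one, Matrix.one_mul]

/-- A minimal admissible `Cl_{n,0}`-module is a Clifford system of least size with a definite
form. -/
lemma IsMinimalAdmissible.exists_system {n : ℕ} {V : Type} [AddCommGroup V] [Module ℝ V]
    {B : V →ₗ[ℝ] V →ₗ[ℝ] ℝ} {J : (Fin (n + 0) → ℝ) →ₗ[ℝ] V →ₗ[ℝ] V}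
    (h : IsMinimalAdmissible n 0 V B J) :
    IsLeastCliffordDim (Fin n) (Module.finrank ℝ V) ∧
    ∃ (e : V ≃ₗ[ℝ] (Fin (Module.finrank ℝ V) → ℝ))
      (K : Fin n → Matrix (Fin (Module.finrank ℝ V)) (Fin (Module.finrank ℝ V)) ℝ) (c : ℝ),
      IsCliffordSystem K ∧ c ≠ 0 ∧
      ∀ i v w, B (J (Pi.single (finCongr (add_zero n).symm i) 1) v) w =
        c * (K i *ᵥ e v ⬝ᵥ e w) := by
  obtain ⟨⟨e, K, S, hK, hKt, hJ, hB, hS, hunit, hKS⟩, hpos, hmin⟩ :=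
    h.exists_coordinates (finCongr (add_zero n).symm) (by norm_num) (sform_zero_right_self n)
  have : Nonempty (Fin (Module.finrank ℝ V)) := ⟨⟨0, hpos⟩⟩
  have hsys : IsCliffordSystem K := ⟨hK, fun i => by simpa using hKt i⟩
  have hleast : IsLeastCliffordDim (Fin n) (Module.finrank ℝ V) := by
    refine ⟨⟨_, _, _, this, K, hsys, Fintype.card_fin _⟩, ?_⟩
    rintro d ⟨κ, _, _, _, K', hK', rfl⟩
    exact hmin κ K' 1 hK'.toIsCliffordFamily transpose_one isUnit_one fun i => by
      simp [hK'.skew]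
  refine ⟨hleast, ?_⟩
  obtain ⟨c, rfl⟩ := hsys.isSymmIrreducible (by rwa [Fintype.card_fin]) S hS fun i => by
    have := hKS i
    rwa [hsys.skew, Matrix.neg_mul, neg_inj] at this
  refine ⟨e, K, c, hsys, ?_, fun i v w => ?_⟩
  · rintro rfl
    simp at hunit
  · rw [hB, hJ, Matrix.smul_mulVec, Matrix.one_mulVec, dotProduct_smul, smul_eq_mul]

/-- A minimal admissible `Cl_{0,n}`-module is a graded Clifford system of least size. -/
lemma IsMinimalAdmissible.exists_graded_system {n : ℕ} {V : Type} [AddCommGroup V] [Module ℝ V]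
    {B : V →ₗ[ℝ] V →ₗ[ℝ] ℝ} {J : (Fin (0 + n) → ℝ) →ₗ[ℝ] V →ₗ[ℝ] V}
    (h : IsMinimalAdmissible 0 n V B J) :
    (0 < Module.finrank ℝ V ∧ ∀ (κ : Type) [Fintype κ] [DecidableEq κ] [Nonempty κ]
      (K : Fin n → Matrix κ κ ℝ) (τ : Matrix κ κ ℝ), IsCliffordSystem K →
      IsCliffordGrading K τ → Module.finrank ℝ V ≤ Fintype.card κ) ∧
    ∃ (e : V ≃ₗ[ℝ] (Fin (Module.finrank ℝ V) → ℝ))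
      (K : Fin n → Matrix (Fin (Module.finrank ℝ V)) (Fin (Module.finrank ℝ V)) ℝ)
      (τ : Matrix (Fin (Module.finrank ℝ V)) (Fin (Module.finrank ℝ V)) ℝ) (c : ℝ),
      IsCliffordSystem K ∧ IsCliffordGrading K τ ∧ c ≠ 0 ∧
      ∀ i v w, B (J (Pi.single (finCongr (zero_add n).symm i) 1) v) w =
        c * (K i *ᵥ e v ⬝ᵥ e w) := by
  obtain ⟨⟨e, K, S, hK, hKt, hJ, hB, hS, hunit, hKS⟩, hpos, hmin⟩ :=
    h.exists_coordinates (finCongr (zero_add n).symm) (by norm_num) (sform_zero_left_self n)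
  have : Nonempty (Fin (Module.finrank ℝ V)) := ⟨⟨0, hpos⟩⟩
  simp only [one_smul] at hKt
  refine ⟨⟨hpos, fun κ _ _ _ L τ hL hτ => ?_⟩, ?_⟩
  · obtain ⟨h1, h2, h3⟩ := hL.isCliffordFamily_grading_mul hτ
    exact hmin κ _ τ h1 hτ.symm h2 h3
  have hKS' (i) : K i * S = -(S * K i) := by rw [← hKS, hKt]
  have hcomm (i) : S * S * K i = K i * (S * S) := by
    rw [← Matrix.mul_assoc, hKS', Matrix.neg_mul, Matrix.mul_assoc S (K i), hKS', Matrix.mul_neg,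
      neg_neg, Matrix.mul_assoc]
  obtain ⟨κ, _, _, _, U, μ, hU, hTU, hst⟩ :=
    exists_eigenspace_isometry (S * S) (by rw [transpose_mul, hS])
  have hSU : U * (Uᵀ * (S * U)) = S * U := hst S (Matrix.mul_assoc _ _ _)
  have hsqU : (Uᵀ * (S * U)) * (Uᵀ * (S * U)) = μ • (1 : Matrix κ κ ℝ) := by
    rw [Matrix.mul_assoc, Matrix.mul_assoc, hSU, ← Matrix.mul_assoc S, hTU, Matrix.mul_smul, hU]
  have hμ0 : μ ≠ 0 := by
    rintro rfl
    rw [zero_smul] at hTU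
    obtain ⟨u, hu⟩ := hunit.mul hunit
    have hU0 : U = 0 := by
      calc U = ((↑u⁻¹ : Matrix _ _ ℝ) * (S * S)) * U := by rw [← hu, Units.inv_mul, Matrix.one_mul]
        _ = 0 := by rw [Matrix.mul_assoc, hTU, Matrix.mul_zero]
    rw [hU0, Matrix.mul_zero] at hU
    exact zero_ne_one hU
  have hμ : 0 < μ := by
    refine lt_of_le_of_ne ?_ hμ0.symm
    have h1 : (S * U)ᵀ * (S * U) = μ • (1 : Matrix κ κ ℝ) := by
      rw [transpose_mul, hS, Matrix.mul_assoc, ← Matrix.mul_assoc S, hTU, Matrix.mul_smul, hU]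
    obtain ⟨o⟩ := ‹Nonempty κ›
    have h2 := congrFun (congrFun h1 o) o
    rw [Matrix.mul_apply] at h2
    simp only [transpose_apply, Matrix.smul_apply, one_apply_eq, smul_eq_mul, mul_one] at h2
    rw [← h2]
    exact Finset.sum_nonneg fun a _ => mul_self_nonneg _
  have hSμ : S * S = μ • 1 := by
    refine eq_smul_one_of_card_eq hU hTU ?_
    have hKst (i) := hst (K i) (hcomm i)
    rw [Fintype.card_fin]
    refine hmin κ (fun i => Uᵀ * (K i * U)) (Uᵀ * (S * U)) (hK.compress hU hKst) ?_ ?_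
      fun i => ?_
    · simp [hS, Matrix.mul_assoc]
    · refine IsUnit.of_mul_eq_one (μ⁻¹ • (Uᵀ * (S * U))) ?_
      rw [Matrix.mul_smul, hsqU, smul_smul, inv_mul_cancel₀ hμ0, one_smul]
    · have ht : (Uᵀ * (K i * U))ᵀ = Uᵀ * (K i * U) := by simp [hKt, Matrix.mul_assoc]
      rw [ht, Matrix.mul_assoc, Matrix.mul_assoc, hSU, Matrix.mul_assoc Uᵀ (S * U),
        Matrix.mul_assoc S, hKst, ← Matrix.mul_assoc (K i), ← Matrix.mul_assoc S, hKS']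
      simp
  have hs := Real.mul_self_sqrt hμ.le
  have hs0 := (Real.sqrt_pos.2 hμ).ne'
  have hone : (√μ)⁻¹ * ((√μ)⁻¹ * μ) = 1 := by field_simp; nlinarith
  set τ := (√μ)⁻¹ • S with hτ
  have hττ : τ * τ = 1 := by
    rw [hτ, Matrix.smul_mul, Matrix.mul_smul, hSμ, smul_smul, smul_smul, mul_assoc, hone, one_smul]
  have hτt : τᵀ = τ := by rw [hτ, transpose_smul, hS]
  have hKτ (i) : K i * τ = -(τ * K i) := by
    rw [hτ, Matrix.mul_smul, hKS', Matrix.smul_mul, smul_neg]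
  have hmul (i j) : τ * K i * (τ * K j) = -(K i * K j) := by
    rw [Matrix.mul_assoc, ← Matrix.mul_assoc (K i), hKτ, Matrix.neg_mul, Matrix.mul_neg,
      ← Matrix.mul_assoc, ← Matrix.mul_assoc, hττ, Matrix.one_mul]
  refine ⟨e, fun i => τ * K i, τ, √μ, ⟨⟨fun i => ?_, fun i j hij => ?_⟩, fun i => ?_⟩,
    ⟨hτt, hττ, fun i => ?_⟩, hs0, fun i v w => ?_⟩
  · rw [hmul, hK.sq]; simp
  · rw [hmul, hmul, hK.anti i j hij]
  · rw [transpose_mul, hτt, hKt, hKτ]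
  · rw [Matrix.mul_assoc, hKτ, Matrix.mul_neg]
  · have hSτ : S * K i = √μ • (τ * K i) := by
      rw [hτ, Matrix.smul_mul, smul_smul, mul_inv_cancel₀ hs0, one_smul]
    rw [hB, hJ, Matrix.dotProduct_mulVec, ← Matrix.mulVec_transpose, hS, Matrix.mulVec_mulVec,
      hSτ, Matrix.smul_mulVec, smul_dotProduct, smul_eq_mul]

/-- The least sizes of Clifford systems of ranks `n` and `n + 1`. -/
lemma isLeastCliffordDim_succ_eq_two_mul {n d d' : ℕ} (hn : n % 8 = 0 ∨ n % 8 = 1)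
    (hd : IsLeastCliffordDim (Fin n) d) (hd' : IsLeastCliffordDim (Fin (n + 1)) d') :
    d' = 2 * d := by
  have hdiv := Nat.div_add_mod n 8
  rcases hn with h | h <;> rw [h] at hdiv
  · rw [isLeastCliffordDim_eq (q := n / 8) (j := 0) (c := 1) (by omega) (by simp) hd,
      isLeastCliffordDim_eq (q := n / 8) (j := 1) (c := 2) (by omega) (by simp) hd']
    ring
  · rw [isLeastCliffordDim_eq (q := n / 8) (j := 1) (c := 2) (by omega) (by simp) hd,
      isLeastCliffordDim_eq (q := n / 8) (j := 2) (c := 4) (by omega) (by simp) hd']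
    ring

lemma isLeastCliffordDim_succ_eq {n d d' : ℕ} (hn : n % 8 = 4 ∨ n % 8 = 5)
    (hd : IsLeastCliffordDim (Fin n) d) (hd' : IsLeastCliffordDim (Fin (n + 1)) d') :
    d' = d := by
  have hdiv := Nat.div_add_mod n 8
  rcases hn with h | h <;> rw [h] at hdiv
  · rw [isLeastCliffordDim_eq (q := n / 8) (j := 4) (c := 8) (by omega) (by simp) hd,
      isLeastCliffordDim_eq (q := n / 8) (j := 5) (c := 8) (by omega) (by simp) hd']
  · rw [isLeastCliffordDim_eq (q := n / 8) (j := 5) (c := 8) (by omega) (by simp) hd,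
      isLeastCliffordDim_eq (q := n / 8) (j := 6) (c := 8) (by omega) (by simp) hd']

/-- In the exceptional ranks a least system is smaller than every graded one. -/
lemma IsLeastCliffordDim.lt_card_of_grading {n d : ℕ} (hn : (n + 1) % 8 = 3 ∨ (n + 1) % 8 = 5 ∨
      (n + 1) % 8 = 6 ∨ (n + 1) % 8 = 7) (hd : IsLeastCliffordDim (Fin (n + 1)) d)
    {κ : Type} [Fintype κ] [DecidableEq κ] [Nonempty κ] {J : Fin (n + 1) → Matrix κ κ ℝ}
    {τ : Matrix κ κ ℝ} (hJ : IsCliffordSystem J) (hτ : IsCliffordGrading J τ) :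
    d < Fintype.card κ := by
  obtain ⟨κ', _, _, _, J', hJ', hcard⟩ := hJ.exists_half hτ
  have hpos : 0 < Fintype.card κ' := Fintype.card_pos
  suffices d ≤ Fintype.card κ' by omega
  by_cases h4 : n % 4 = 2
  · obtain ⟨L, hL⟩ := hJ'.exists_succ_of_mod_four h4
    exact hL.le_card hd
  · obtain ⟨d', hd'⟩ := hJ'.exists_isLeast
    rw [isLeastCliffordDim_succ_eq (by omega) hd' hd]
    exact hJ'.le_card hd'

/-- In the remaining ranks a graded system of least size is a least system. -/
lemma IsLeastCliffordDim.exists_grading {n d : ℕ} (hn : (n + 1) % 8 = 0 ∨ (n + 1) % 8 = 1 ∨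
      (n + 1) % 8 = 2 ∨ (n + 1) % 8 = 4) (hd : IsLeastCliffordDim (Fin (n + 1)) d) :
    ∃ (κ : Type) (_ : Fintype κ) (_ : DecidableEq κ) (_ : Nonempty κ)
      (J : Fin (n + 1) → Matrix κ κ ℝ) (τ : Matrix κ κ ℝ), IsCliffordSystem J ∧
      IsCliffordGrading J τ ∧ Fintype.card κ = d := by
  obtain ⟨κ, _, _, hne, J, hJ, hcard⟩ := hd.1
  by_cases h4 : (n + 1) % 4 = 0
  · obtain ⟨τ, hτ⟩ := hJ.exists_grading_of_mod_four h4
    exact ⟨κ, _, _, hne, J, τ, hJ, hτ, hcard⟩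
  · obtain ⟨d', hd'⟩ := hJ.castSucc.exists_isLeast
    obtain ⟨κ', _, _, _, J', hJ', hcard'⟩ := hd'.1
    obtain ⟨L, τ, hL, hτ⟩ := hJ'.exists_double
    refine ⟨κ' ⊕ κ', inferInstance, inferInstance, inferInstance, L, τ, hL, hτ, ?_⟩
    rw [Fintype.card_sum, isLeastCliffordDim_succ_eq_two_mul (by omega) hd' hd]
    omega

theorem stmt6 (r : ℕ) (hr : 1 ≤ r)
    (V1 : Type) [AddCommGroup V1] [Module ℝ V1]
    (B1 : V1 →ₗ[ℝ] V1 →ₗ[ℝ] ℝ)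
    (J1 : (Fin (r + 0) → ℝ) →ₗ[ℝ] V1 →ₗ[ℝ] V1)
    (br1 : V1 →ₗ[ℝ] V1 →ₗ[ℝ] (Fin (r + 0) → ℝ))
    (hadm1 : IsMinimalAdmissible r 0 V1 B1 J1)
    (hbr1 : IsHBracket r 0 V1 B1 J1 br1)
    (V2 : Type) [AddCommGroup V2] [Module ℝ V2]
    (B2 : V2 →ₗ[ℝ] V2 →ₗ[ℝ] ℝ)
    (J2 : (Fin (0 + r) → ℝ) →ₗ[ℝ] V2 →ₗ[ℝ] V2)
    (br2 : V2 →ₗ[ℝ] V2 →ₗ[ℝ] (Fin (0 + r) → ℝ))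
    (hadm2 : IsMinimalAdmissible 0 r V2 B2 J2)
    (hbr2 : IsHBracket 0 r V2 B2 J2 br2)
    :
    (∃ f : (V1 × (Fin (r + 0) → ℝ)) ≃ₗ[ℝ] (V2 × (Fin (0 + r) → ℝ)),
      IsLieIso br1 br2 f) ↔
    (r % 8 = 0 ∨ r % 8 = 1 ∨ r % 8 = 2 ∨ r % 8 = 4) := by
  obtain ⟨n, rfl⟩ : ∃ n, r = n + 1 := ⟨r - 1, by omega⟩
  obtain ⟨hleast, e1, K1, c1, hK1, hc1, hB1⟩ := hadm1.exists_system
  obtain ⟨⟨hpos2, hmin2⟩, e2, K2, τ, c2, hK2, hτ, hc2, hB2⟩ := hadm2.exists_graded_system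
  have := hadm1.1.1
  have := hadm2.1.1
  have hne1 : Nonempty (Fin (Module.finrank ℝ V1)) := by
    have := hadm1.1.2.1
    exact ⟨⟨0, Module.finrank_pos⟩⟩
  have hne2 : Nonempty (Fin (Module.finrank ℝ V2)) := ⟨⟨0, hpos2⟩⟩
  constructor
  · rintro ⟨f, -⟩
    have hdim : Module.finrank ℝ V1 = Module.finrank ℝ V2 := by
      have := f.finrank_eq
      simp only [Module.finrank_prod, Module.finrank_fin_fun] at this
      omega
    by_contra hcon
    have := hleast.lt_card_of_grading (by omega) hK2 hτ
    rw [Fintype.card_fin] at this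
    omega
  · intro hr8
    have hdim : Module.finrank ℝ V2 = Module.finrank ℝ V1 := by
      refine le_antisymm ?_ (by simpa using hK2.le_card hleast)
      obtain ⟨κ, _, _, _, L, σ, hL, hσ, hcard⟩ := hleast.exists_grading hr8
      exact (hmin2 κ L σ hL hσ).trans hcard.le
    obtain ⟨O, hO, hO1, hO2⟩ := hK2.exists_orthogonal_intertwiner hK1
      (by rw [Fintype.card_fin]; omega)
      (hK2.isSymmIrreducible (by rwa [Fintype.card_fin, hdim]))
      (hK1.isSymmIrreducible (by rwa [Fintype.card_fin]))
    let A : V1 ≃ₗ[ℝ] V2 := (e1.trans (Matrix.toLin'OfInv hO1 hO2)).trans e2.symm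
    have hA (v : V1) : e2 (A v) = O *ᵥ e1 v := e2.apply_symm_apply _
    have hc : -(c2 / c1) ≠ 0 := neg_ne_zero.2 (div_ne_zero hc2 hc1)
    let C : (Fin (n + 1 + 0) → ℝ) ≃ₗ[ℝ] (Fin (0 + (n + 1)) → ℝ) :=
      (LinearEquiv.funCongrLeft ℝ ℝ (finCongr (by omega))).trans
        (LinearEquiv.smulOfNeZero ℝ _ _ hc)
    refine ⟨A.prodCongr C, fun x y => ?_⟩
    have key (v w : V1) : C (br1 v w) = br2 (A v) (A w) := by
      ext i
      obtain ⟨i, rfl⟩ := (finCongr (zero_add (n + 1)).symm).surjective i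
      have h1 := hbr1 (Pi.single (finCongr (add_zero (n + 1)).symm i) 1) v w
      have h2 := hbr2 (Pi.single (finCongr (zero_add (n + 1)).symm i) 1) (A v) (A w)
      rw [sform_zero_right_single, hB1] at h1
      rw [sform_zero_left_single, hB2, hA, hA, Matrix.mulVec_mulVec, hO, ← Matrix.mulVec_mulVec,
        Matrix.dotProduct_mulVec, ← Matrix.mulVec_transpose, Matrix.mulVec_mulVec, hO1,
        Matrix.one_mulVec] at h2
      have h3 : C (br1 v w) (finCongr (zero_add (n + 1)).symm i) =
          -(c2 / c1) * br1 v w (finCongr (add_zero (n + 1)).symm i) := rfl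
      rw [h3, h1, ← neg_neg (br2 _ _ _), h2]
      field_simp
    change (A 0, C (br1 x.1 y.1)) = (0, br2 (A x.1) (A y.1))
    rw [key, map_zero]
end
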